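/- arXiv:0809.4349 — 3 statements merged into one kernel-verified Lean document; each statement's English description precedes it below -/
import Mathlib

section
/- Let α > 0 and let ν be a Borel probability measure on V = ℝ^d such that ν({x : |x| > t}) ≤ D₀·t^{-α} for every t > 0 and some constant D₀. Let δ > 0, 0 ≤ β < α, γ ≥ 0 with γ + δ > α, let T ⊆ (0,∞) have 0 as an accumulation point, and let f : T × V → ℂ be measurable with |f(c,x)| ≤ D₁·c^{δ+β}·|x|^β whenever c|x| ≥ 1, and |f(c,x)| ≤ D₂·c^{δ+γ}·|x|^γ whenever c|x| ≤ 1, for constants D₁, D₂. Then lim_{c→0, c∈T} c^{-α} ∫_V f(c,x) dν(x) = 0. -/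
open MeasureTheory Filter Topology
open scoped ENNReal NNReal

noncomputable section

/-- A finite measure whose norm tail decays like `t ^ (-α)` has finite moments of every
order `s < α`. -/
theorem integrable_norm_rpow_of_tail_le {E : Type*} [NormedAddCommGroup E] [MeasurableSpace E]
    [OpensMeasurableSpace E] {μ : Measure E} [IsFiniteMeasure μ] {α D s : ℝ}
    (htail : ∀ t : ℝ, 0 < t → μ {x | t < ‖x‖} ≤ ENNReal.ofReal (D * t ^ (-α)))
    (hs0 : 0 ≤ s) (hs : s < α) : Integrable (fun x => ‖x‖ ^ s) μ := by
  rcases hs0.eq_or_lt with rfl | hs0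
  · simp
  have hmeas : Measurable fun x : E => ‖x‖ ^ s := measurable_norm.pow_const s
  refine ⟨hmeas.aestronglyMeasurable, ?_⟩
  rw [hasFiniteIntegral_iff_ofReal (.of_forall fun x => by positivity),
    lintegral_rpow_eq_lintegral_meas_lt_mul μ (.of_forall fun x => norm_nonneg x)
      measurable_norm.aemeasurable hs0]
  refine ENNReal.mul_lt_top ENNReal.ofReal_lt_top ?_
  rw [← Set.Ioc_union_Ioi_eq_Ioi (zero_le_one' ℝ)]
  refine (lintegral_union_le _ _ _).trans_lt (ENNReal.add_lt_top.2 ⟨?_, ?_⟩)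
  · have hint : IntegrableOn (fun t : ℝ => t ^ (s - 1)) (Set.Ioc 0 1) :=
      (intervalIntegral.intervalIntegrable_rpow' (by linarith)).1
    calc ∫⁻ t in Set.Ioc (0 : ℝ) 1, μ {x | t < ‖x‖} * ENNReal.ofReal (t ^ (s - 1))
        ≤ ∫⁻ t in Set.Ioc (0 : ℝ) 1, μ Set.univ * ENNReal.ofReal (t ^ (s - 1)) := by
          gcongr
          exact Set.subset_univ _
      _ = μ Set.univ * ∫⁻ t in Set.Ioc (0 : ℝ) 1, ENNReal.ofReal (t ^ (s - 1)) :=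
          lintegral_const_mul' _ _ (measure_ne_top μ _)
      _ < ∞ := ENNReal.mul_lt_top (measure_lt_top μ _) hint.lintegral_lt_top
  · have hint : IntegrableOn (fun t : ℝ => D * t ^ (s - 1 - α)) (Set.Ioi 1) :=
      (integrableOn_Ioi_rpow_of_lt (by linarith) one_pos).const_mul D
    refine lt_of_le_of_lt (setLIntegral_mono' measurableSet_Ioi fun t ht => ?_)
      hint.lintegral_lt_top
    have ht0 : (0 : ℝ) < t := one_pos.trans ht
    calc μ {x | t < ‖x‖} * ENNReal.ofReal (t ^ (s - 1))
        ≤ ENNReal.ofReal (D * t ^ (-α)) * ENNReal.ofReal (t ^ (s - 1)) := by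
          gcongr
          exact htail t ht0
      _ = ENNReal.ofReal (D * t ^ (s - 1 - α)) := by
          rw [← ENNReal.ofReal_mul' (by positivity), mul_assoc, ← Real.rpow_add ht0]
          ring_nf

/-- If `ν` has a polynomial tail bound of order `α` and `f(c,·)` satisfies the two-scale
bounds `|f(c,x)| ≤ D₁ c^{δ+β} |x|^β` for `c|x| ≥ 1` (with `β < α`) and
`|f(c,x)| ≤ D₂ c^{δ+γ} |x|^γ` for `c|x| ≤ 1` (with `γ + δ > α`), then
`c^{-α} ∫ f(c,x) dν(x) → 0` as `c → 0` along `T`. -/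
theorem tendsto_integral_two_scale_bound_zero {d : ℕ}
    (α : ℝ) (hα : 0 < α)
    (ν : Measure (EuclideanSpace ℝ (Fin d))) (hν : IsProbabilityMeasure ν)
    (D₀ : ℝ) (htail : ∀ t : ℝ, 0 < t →
      ν {x : EuclideanSpace ℝ (Fin d) | t < ‖x‖} ≤ ENNReal.ofReal (D₀ * t ^ (-α)))
    (δ β γ : ℝ) (hδ : 0 < δ) (hβ0 : 0 ≤ β) (hβα : β < α) (hγ0 : 0 ≤ γ) (hγδ : α < γ + δ)
    (T : Set ℝ) (hT : T ⊆ Set.Ioi (0 : ℝ)) (hT0 : (nhdsWithin (0 : ℝ) T).NeBot)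
    (f : ℝ → EuclideanSpace ℝ (Fin d) → ℂ)
    (hfm : ∀ c ∈ T, AEStronglyMeasurable (f c) ν)
    (D₁ D₂ : ℝ)
    (hb1 : ∀ c ∈ T, ∀ x : EuclideanSpace ℝ (Fin d),
      1 ≤ c * ‖x‖ → ‖f c x‖ ≤ D₁ * c ^ (δ + β) * ‖x‖ ^ β)
    (hb2 : ∀ c ∈ T, ∀ x : EuclideanSpace ℝ (Fin d),
      c * ‖x‖ ≤ 1 → ‖f c x‖ ≤ D₂ * c ^ (δ + γ) * ‖x‖ ^ γ) :
    Tendsto (fun c : ℝ => (c ^ (-α)) • ∫ x, f c x ∂ν)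
      (nhdsWithin (0 : ℝ) T) (𝓝 0) := by
  obtain ⟨s, hβs, hsα, hs⟩ : ∃ s, β ≤ s ∧ s < α ∧ α < δ + s :=
    ⟨max β (α - δ / 2), le_max_left _ _, max_lt hβα (by linarith),
      by linarith [le_max_right β (α - δ / 2)]⟩
  obtain ⟨r, hr0, hrγ, hrα, hr⟩ : ∃ r, 0 ≤ r ∧ r ≤ γ ∧ r < α ∧ α < δ + r := by
    refine ⟨min γ (max 0 (α - δ / 2)), le_min hγ0 (le_max_left _ _), min_le_left _ _,
      (min_le_right _ _).trans_lt (max_lt hα (by linarith)), ?_⟩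
    have : α - δ < min γ (max 0 (α - δ / 2)) :=
      lt_min (by linarith) (lt_max_of_lt_right (by linarith))
    linarith
  have hs_int := integrable_norm_rpow_of_tail_le htail (hβ0.trans hβs) hsα
  have hr_int := integrable_norm_rpow_of_tail_le htail hr0 hrα
  have hbound : ∀ c ∈ T, ∀ x : EuclideanSpace ℝ (Fin d),
      ‖f c x‖ ≤ |D₁| * c ^ (δ + s) * ‖x‖ ^ s + |D₂| * c ^ (δ + r) * ‖x‖ ^ r := by
    intro c hc x
    have hc0 : 0 < c := hT hc
    have hsplit : ∀ D u : ℝ, D * c ^ (δ + u) * ‖x‖ ^ u = D * c ^ δ * (c * ‖x‖) ^ u := by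
      intro D u
      rw [Real.rpow_add hc0, Real.mul_rpow hc0.le (norm_nonneg x)]
      ring
    rcases le_total 1 (c * ‖x‖) with h | h
    · refine (hb1 c hc x h).trans (le_add_of_le_of_nonneg ?_ (by positivity))
      rw [hsplit, hsplit]
      gcongr
      exact le_abs_self D₁
    · refine (hb2 c hc x h).trans (le_add_of_nonneg_of_le (by positivity) ?_)
      rw [hsplit, hsplit]
      gcongr ?_ * _ * ?_
      exacts [le_abs_self D₂,
        Real.rpow_le_rpow_of_exponent_ge' (by positivity) h hr0 hrγ]
  have hlim : ∀ u : ℝ, α < δ + u →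
      Tendsto (fun c : ℝ => c ^ (δ + u - α)) (𝓝[T] 0) (𝓝 0) := by
    intro u hu
    have hcont := (Real.continuousAt_rpow_const 0 (δ + u - α) (.inr (by linarith))).tendsto
    rw [Real.zero_rpow (by linarith)] at hcont
    exact hcont.mono_left nhdsWithin_le_nhds
  have hmajorant := ((hlim s hs).const_mul (|D₁| * ∫ x, ‖x‖ ^ s ∂ν)).add
    ((hlim r hr).const_mul (|D₂| * ∫ x, ‖x‖ ^ r ∂ν))
  rw [mul_zero, mul_zero, add_zero] at hmajorant
  refine squeeze_zero_norm' ?_ hmajorant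
  filter_upwards [self_mem_nhdsWithin] with c hc
  have hc0 : 0 < c := hT hc
  have hle := norm_integral_le_of_norm_le
    ((hs_int.const_mul (|D₁| * c ^ (δ + s))).add (hr_int.const_mul (|D₂| * c ^ (δ + r))))
    (.of_forall (hbound c hc))
  simp only [Pi.add_apply] at hle
  rw [integral_add (hs_int.const_mul _) (hr_int.const_mul _), integral_const_mul,
    integral_const_mul] at hle
  rw [norm_smul, Real.norm_of_nonneg (by positivity)]
  refine (mul_le_mul_of_nonneg_left hle (by positivity)).trans_eq ?_
  rw [sub_eq_add_neg, sub_eq_add_neg, Real.rpow_add hc0 (δ + s), Real.rpow_add hc0 (δ + r)]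
  ring
end
end

section
/- Let ν be a Borel probability measure on V = ℝ^d and Λ a Radon measure on V ∖ {0} such that lim_{t→0⁺} t^{-2} ∫_V f(tx) dν(x) = ∫ f dΛ for every bounded continuous f : V → ℂ vanishing on a neighborhood of 0. Let v₁, v₂ ∈ V, h(x) = ⟨x,v₁⟩⟨x,v₂⟩, C₀ ∈ ℂ, and let f : V → ℂ be continuous with f(x) = C₀·h(x) + o(|x|²) as x → 0 and |f(x)| ≤ C·|x|^{1+η} for all x, for some constants C and 0 < η < 1. Then for every β > 1: lim_{t→0⁺} (t²·|log t|)^{-1} ∫_V f(tx) dν(x) = (C₀/log β) ∫_{1<|x|≤β} h(x) dΛ(x); in particular the right-hand side does not depend on β. Moreover Λ is homogeneous of degree 2 under scalar dilations: ∫ f(sx) dΛ(x) = s² ∫ f dΛ for every s > 0 and every bounded continuous f vanishing near 0. -/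
open MeasureTheory Filter Topology
open scoped InnerProductSpace ENNReal NNReal

noncomputable section

/-- The quadratic function `h(x) = ⟨x,v₁⟩⟨x,v₂⟩`. -/
def quadH {d : ℕ} (v₁ v₂ : EuclideanSpace ℝ (Fin d)) (x : EuclideanSpace ℝ (Fin d)) : ℝ :=
  ⟪x, v₁⟫_ℝ * ⟪x, v₂⟫_ℝ

/-- A logarithmic Cesàro mean at `0` converges to the limit at `0` of the averaged function. -/
theorem tendsto_log_average {Φ : ℝ → ℝ} {I : ℝ} (hΦ : ContinuousOn Φ (Set.Ioi 0))
    (hlim : Tendsto Φ (𝓝[>] 0) (𝓝 I)) :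
    Tendsto (fun t : ℝ => |Real.log t|⁻¹ * ∫ s in t..1, Φ s / s) (𝓝[>] 0) (𝓝 I) := by
  have hlog : Tendsto (fun t : ℝ => |Real.log t|) (𝓝[>] 0) atTop :=
    tendsto_abs_atBot_atTop.comp Real.tendsto_log_nhdsGT_zero
  have hint : ∀ a b : ℝ, 0 < a → 0 < b →
      IntervalIntegrable (fun s => (Φ s - I) / s) volume a b := by
    intro a b ha hb
    apply ContinuousOn.intervalIntegrable
    have hsub : Set.uIcc a b ⊆ Set.Ioi 0 := fun x hx => lt_of_lt_of_le (lt_min ha hb) hx.1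
    exact ((hΦ.mono hsub).sub continuousOn_const).div continuousOn_id
      fun x hx => (hsub hx).ne'
  rw [Metric.tendsto_nhds]
  intro ε hε
  obtain ⟨δ, hδ, hδ'⟩ : ∃ δ > 0, ∀ s, 0 < s → s < δ → |Φ s - I| < ε / 2 := by
    have h := Metric.tendsto_nhdsWithin_nhds.1 hlim (ε / 2) (by positivity)
    obtain ⟨δ, hδ, h⟩ := h
    refine ⟨δ, hδ, fun s hs hsδ => ?_⟩
    have := h (x := s) hs (by simpa [Real.dist_eq, abs_of_pos hs] using hsδ)
    rwa [Real.dist_eq] at this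
  set ρ := min (δ / 2) (1 / 2) with hρ
  have hρ0 : 0 < ρ := by positivity
  have hρδ : ρ < δ := lt_of_le_of_lt (min_le_left _ _) (by linarith)
  have hρ1 : ρ < 1 := lt_of_le_of_lt (min_le_right _ _) (by norm_num)
  set B := |∫ s in ρ..1, (Φ s - I) / s| with hB
  filter_upwards [hlog.eventually_gt_atTop (2 * B / ε), self_mem_nhdsWithin,
    Ioo_mem_nhdsGT hρ0] with t htB ht0 htρ
  have ht0 : 0 < t := ht0
  have htρ : t < ρ := htρ.2
  have hneg : Real.log t < 0 := Real.log_neg ht0 (htρ.trans hρ1)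
  have hL : 0 < |Real.log t| := abs_pos.2 hneg.ne
  have hinv : ∫ s in t..1, s⁻¹ = |Real.log t| := by
    rw [integral_inv_of_pos ht0 one_pos, abs_of_neg hneg, one_div, Real.log_inv]
  have hIint : IntervalIntegrable (fun s : ℝ => I * s⁻¹) volume t 1 := by
    apply ContinuousOn.intervalIntegrable
    refine continuousOn_const.mul (continuousOn_inv₀.mono fun x hx => ?_)
    exact (lt_of_lt_of_le (lt_min ht0 one_pos) hx.1).ne'
  have hsplit : ∫ s in t..1, Φ s / s
      = (∫ s in t..ρ, (Φ s - I) / s) + (∫ s in ρ..1, (Φ s - I) / s) + I * |Real.log t| := by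
    rw [intervalIntegral.integral_add_adjacent_intervals (hint t ρ ht0 hρ0)
      (hint ρ 1 hρ0 one_pos), ← hinv, ← intervalIntegral.integral_const_mul,
      ← intervalIntegral.integral_add (hint t 1 ht0 one_pos) hIint]
    congr 1
    ext s
    ring
  have hmain : |∫ s in t..ρ, (Φ s - I) / s| ≤ ε / 2 * |Real.log t| := by
    have h1 : ‖∫ s in t..ρ, (Φ s - I) / s‖ ≤ ∫ s in t..ρ, ε / 2 * s⁻¹ := by
      apply intervalIntegral.norm_integral_le_of_norm_le htρ.le
      · refine Eventually.of_forall fun s hs => ?_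
        have hs0 : 0 < s := ht0.trans hs.1
        rw [Real.norm_eq_abs, abs_div, abs_of_pos hs0, div_eq_mul_inv]
        gcongr
        exact (hδ' s hs0 (hs.2.trans_lt hρδ)).le
      · apply ContinuousOn.intervalIntegrable
        refine continuousOn_const.mul (continuousOn_inv₀.mono fun x hx => ?_)
        exact (lt_of_lt_of_le (lt_min ht0 hρ0) hx.1).ne'
    rw [intervalIntegral.integral_const_mul, integral_inv_of_pos ht0 hρ0,
      Real.log_div hρ0.ne' ht0.ne'] at h1
    refine h1.trans ?_
    gcongr
    rw [abs_of_neg hneg]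
    linarith [Real.log_neg hρ0 hρ1]
  rw [Real.dist_eq, hsplit]
  have : |Real.log t|⁻¹ * ((∫ s in t..ρ, (Φ s - I) / s) + (∫ s in ρ..1, (Φ s - I) / s)
      + I * |Real.log t|) - I
      = |Real.log t|⁻¹ * ((∫ s in t..ρ, (Φ s - I) / s) + (∫ s in ρ..1, (Φ s - I) / s)) := by
    field_simp
    ring
  rw [this, abs_mul, abs_inv, abs_abs, inv_mul_lt_iff₀ hL]
  calc |(∫ s in t..ρ, (Φ s - I) / s) + (∫ s in ρ..1, (Φ s - I) / s)|
      ≤ ε / 2 * |Real.log t| + B := (abs_add_le _ _).trans (by gcongr)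
    _ < |Real.log t| * ε := by
        rw [div_lt_iff₀ hε] at htB
        linarith

/-- `Λ` is the tail measure of `ν` for the exponent `2`, tested against real functions. -/
def IsTailMeasure {E : Type*} [NormedAddCommGroup E] [NormedSpace ℝ E] [MeasurableSpace E]
    (ν Λ : Measure E) : Prop :=
  ∀ g : E → ℝ, Continuous g → (∃ C : ℝ, ∀ x, |g x| ≤ C) →
    (∃ r > (0 : ℝ), ∀ x, ‖x‖ < r → g x = 0) →
    Tendsto (fun t : ℝ => (t ^ 2)⁻¹ * ∫ x, g (t • x) ∂ν) (𝓝[>] 0) (𝓝 (∫ x, g x ∂Λ))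

section Tail

variable {E : Type*} [NormedAddCommGroup E] [NormedSpace ℝ E] [MeasurableSpace E] [BorelSpace E]
  {ν Λ : Measure E}

theorem IsTailMeasure.measure_le [IsProbabilityMeasure ν] (h : IsTailMeasure ν Λ) :
    ∃ K : ℝ, 0 ≤ K ∧ ∀ R : ℝ, 0 < R → ν {x | R ≤ ‖x‖} ≤ ENNReal.ofReal (K / R ^ 2) := by
  set χ : E → ℝ := fun x => max 0 (min 1 (2 * ‖x‖ - 1)) with hχ
  have hχc : Continuous χ := by fun_prop
  have hχ0 : ∀ x, 0 ≤ χ x := fun x => le_max_left _ _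
  have hχ1 : ∀ x, χ x ≤ 1 := fun x => max_le zero_le_one (min_le_left _ _)
  have hlim := h χ hχc ⟨1, fun x => by rw [abs_of_nonneg (hχ0 x)]; exact hχ1 x⟩
    ⟨1 / 2, by norm_num, fun x hx => max_eq_left ((min_le_right _ _).trans (by linarith))⟩
  set L := ∫ x, χ x ∂Λ
  have hL : 0 ≤ L := integral_nonneg hχ0
  have hev := hlim.eventually_le_const (lt_add_one L)
  obtain ⟨δ, hδ, hδ'⟩ := mem_nhdsGT_iff_exists_Ioo_subset.1 hev
  have hδ : 0 < δ := hδ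
  refine ⟨max (L + 1) (δ⁻¹ ^ 2), by positivity, fun R hR => ?_⟩
  by_cases hRδ : R⁻¹ < δ
  · have h1 : ((R⁻¹) ^ 2)⁻¹ * ∫ x, χ (R⁻¹ • x) ∂ν ≤ L + 1 := hδ' ⟨by positivity, hRδ⟩
    have hcont : Continuous fun x : E => χ (R⁻¹ • x) := hχc.comp (continuous_const_smul _)
    have hint : Integrable (fun x => χ (R⁻¹ • x)) ν := by
      refine Integrable.of_bound (C := 1) hcont.measurable.aestronglyMeasurable
        (Eventually.of_forall fun x => ?_)
      rw [Real.norm_eq_abs, abs_of_nonneg (hχ0 _)]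
      exact hχ1 _
    have hset : MeasurableSet {x : E | R ≤ ‖x‖} := measurableSet_le measurable_const measurable_norm
    have h2 : ν.real {x | R ≤ ‖x‖} ≤ ∫ x, χ (R⁻¹ • x) ∂ν := by
      rw [← integral_indicator_one hset]
      refine integral_mono ((integrable_const (1 : ℝ)).indicator hset) hint fun x => ?_
      by_cases hx : R ≤ ‖x‖
      · have : (1 : ℝ) ≤ R⁻¹ * ‖x‖ := by
          rwa [← div_eq_inv_mul, one_le_div hR]
        rw [Set.indicator_of_mem (show x ∈ {x : E | R ≤ ‖x‖} from hx)]
        refine le_max_of_le_right (le_min le_rfl ?_)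
        rw [norm_smul, Real.norm_of_nonneg (by positivity), Pi.one_apply]
        linarith
      · rw [Set.indicator_of_notMem (show x ∉ {x : E | R ≤ ‖x‖} from hx)]
        exact hχ0 _
    rw [← ofReal_measureReal]
    refine ENNReal.ofReal_le_ofReal (h2.trans ?_)
    rw [inv_pow, inv_inv] at h1
    rw [le_div_iff₀ (by positivity), mul_comm]
    exact h1.trans (le_max_left _ _)
  · push Not at hRδ
    refine prob_le_one.trans ?_
    rw [ENNReal.one_le_ofReal, one_le_div (by positivity)]
    refine le_max_of_le_right (pow_le_pow_left₀ hR.le ?_ 2)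
    rwa [le_inv_comm₀ hR hδ]

/-- The part of a moment of order `p < 2` carried by `‖t • x‖ > r` is `O(t ^ 2)`. -/
theorem IsTailMeasure.lintegral_moment_le [IsProbabilityMeasure ν] (h : IsTailMeasure ν Λ)
    {p r : ℝ} (hp0 : 0 < p) (hp2 : p < 2) (hr : 0 < r) :
    ∃ M : ℝ, 0 ≤ M ∧ ∀ t : ℝ, 0 < t →
      ∫⁻ x, ENNReal.ofReal (({y : E | r < ‖y‖}.indicator norm (t • x)) ^ p) ∂ν
        ≤ ENNReal.ofReal (M * t ^ 2) := by
  obtain ⟨K, hK, hKν⟩ := h.measure_le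
  have hfin : IntegrableOn (fun u : ℝ => u ^ (p - 1) / (max u r) ^ 2) (Set.Ioi 0) := by
    rw [← Set.Ioc_union_Ioi_eq_Ioi hr.le]
    refine IntegrableOn.union ?_ ?_
    · have h1 : IntegrableOn (fun u : ℝ => u ^ (p - 1) / r ^ 2) (Set.Ioc 0 r) :=
        ((intervalIntegrable_iff_integrableOn_Ioc_of_le hr.le).1
          (intervalIntegral.intervalIntegrable_rpow' (by linarith))).div_const _
      refine h1.congr_fun (fun u hu => ?_) measurableSet_Ioc
      simp only [max_eq_right hu.2]
    · refine (integrableOn_Ioi_rpow_of_lt (a := p - 1 - 2) (by linarith) hr).congr_fun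
        (fun u hu => ?_) measurableSet_Ioi
      have hu : r < u := hu
      simp only [max_eq_left hu.le]
      rw [Real.rpow_sub (hr.trans hu), Real.rpow_two]
  set M₀ := ∫ u in Set.Ioi 0, u ^ (p - 1) / (max u r) ^ 2 with hM₀
  have hM₀0 : 0 ≤ M₀ := setIntegral_nonneg measurableSet_Ioi fun u hu => by
    have hu : 0 < u := hu
    positivity
  refine ⟨p * K * M₀, by positivity, fun t ht => ?_⟩
  have hmeas : Measurable fun x : E => {y : E | r < ‖y‖}.indicator norm (t • x) :=
    (measurable_norm.indicator (measurableSet_lt measurable_const measurable_norm)).comp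
      (continuous_const_smul t).measurable
  rw [lintegral_rpow_eq_lintegral_meas_le_mul ν
    (Eventually.of_forall fun x => Set.indicator_nonneg (fun y _ => norm_nonneg y) _)
    hmeas.aemeasurable hp0]
  have hbound : ∫⁻ u in Set.Ioi 0, ν {x | u ≤ {y : E | r < ‖y‖}.indicator norm (t • x)}
        * ENNReal.ofReal (u ^ (p - 1))
      ≤ ∫⁻ u in Set.Ioi 0, ENNReal.ofReal (K * t ^ 2)
        * ENNReal.ofReal (u ^ (p - 1) / (max u r) ^ 2) := by
    refine setLIntegral_mono' measurableSet_Ioi fun u hu => ?_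
    have hu : 0 < u := hu
    have hsub : {x | u ≤ {y : E | r < ‖y‖}.indicator norm (t • x)} ⊆ {x | max u r / t ≤ ‖x‖} := by
      intro x hx
      have hx : u ≤ {y : E | r < ‖y‖}.indicator norm (t • x) := hx
      have hmem : t • x ∈ {y : E | r < ‖y‖} := by
        by_contra hn
        rw [Set.indicator_of_notMem hn] at hx
        linarith
      rw [Set.indicator_of_mem hmem] at hx
      have hmem : r < ‖t • x‖ := hmem
      rw [norm_smul, Real.norm_of_nonneg ht.le] at hx hmem
      change max u r / t ≤ ‖x‖
      rw [div_le_iff₀ ht, mul_comm]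
      exact max_le hx hmem.le
    have hm : 0 < max u r := lt_max_of_lt_left hu
    refine (mul_le_mul_left ((measure_mono hsub).trans (hKν _ (by positivity))) _).trans ?_
    rw [← ENNReal.ofReal_mul (by positivity), ← ENNReal.ofReal_mul (by positivity)]
    refine ENNReal.ofReal_le_ofReal (le_of_eq ?_)
    field_simp
  refine (mul_le_mul_right hbound _).trans ?_
  rw [lintegral_const_mul' _ _ ENNReal.ofReal_ne_top, ← ofReal_integral_eq_lintegral_ofReal hfin
    ((ae_restrict_mem measurableSet_Ioi).mono fun u hu => by
      have hu : 0 < u := hu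
      have : 0 ≤ u ^ (p - 1) := by positivity
      change 0 ≤ u ^ (p - 1) / (max u r) ^ 2
      positivity),
    ← ENNReal.ofReal_mul (by positivity), ← ENNReal.ofReal_mul hp0.le]
  refine ENNReal.ofReal_le_ofReal (le_of_eq ?_)
  ring

theorem IsTailMeasure.moment_le [IsProbabilityMeasure ν] (h : IsTailMeasure ν Λ)
    {p r : ℝ} (hp0 : 0 < p) (hp2 : p < 2) (hr : 0 < r) :
    ∃ M : ℝ, 0 ≤ M ∧ ∀ t : ℝ, 0 < t →
      Integrable (fun x => ({y : E | r < ‖y‖}.indicator norm (t • x)) ^ p) ν ∧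
      ∫ x, ({y : E | r < ‖y‖}.indicator norm (t • x)) ^ p ∂ν ≤ M * t ^ 2 := by
  obtain ⟨M, hM, hle⟩ := h.lintegral_moment_le hp0 hp2 hr
  refine ⟨M, hM, fun t ht => ?_⟩
  have hmeas : Measurable fun x : E => ({y : E | r < ‖y‖}.indicator norm (t • x)) ^ p :=
    ((measurable_norm.indicator (measurableSet_lt measurable_const measurable_norm)).comp
      (continuous_const_smul t).measurable).pow_const p
  have hnn : ∀ x : E, 0 ≤ ({y : E | r < ‖y‖}.indicator norm (t • x)) ^ p := fun x =>
    Real.rpow_nonneg (Set.indicator_nonneg (fun y _ => norm_nonneg y) _) _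
  constructor
  · refine ⟨hmeas.aestronglyMeasurable, ?_⟩
    rw [hasFiniteIntegral_iff_ofReal (Eventually.of_forall hnn)]
    exact (hle t ht).trans_lt ENNReal.ofReal_lt_top
  · rw [integral_eq_lintegral_of_nonneg_ae (Eventually.of_forall hnn) hmeas.aestronglyMeasurable]
    exact ENNReal.toReal_le_of_le_ofReal (by positivity) (hle t ht)

theorem IsTailMeasure.integrable_comp_smul [IsProbabilityMeasure ν] (h : IsTailMeasure ν Λ) {f : E → ℂ}
    (hf : Continuous f) {C p : ℝ} (hp0 : 0 < p) (hp2 : p < 2)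
    (hgrow : ∀ x, ‖f x‖ ≤ C * ‖x‖ ^ p) {t : ℝ} (ht : 0 < t) :
    Integrable (fun x => f (t • x)) ν := by
  obtain ⟨M, -, hM⟩ := h.moment_le hp0 hp2 one_pos
  refine (((hM t ht).1.add (integrable_const 1)).const_mul |C|).mono'
    (hf.comp (continuous_const_smul t)).measurable.aestronglyMeasurable
    (Eventually.of_forall fun x => ?_)
  refine (hgrow _).trans ?_
  simp only [Pi.add_apply]
  gcongr
  · exact le_abs_self C
  · by_cases hx : 1 < ‖t • x‖
    · rw [Set.indicator_of_mem (show t • x ∈ {y : E | 1 < ‖y‖} from hx)]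
      linarith
    · rw [Set.indicator_of_notMem (show t • x ∉ {y : E | 1 < ‖y‖} from hx),
        Real.zero_rpow hp0.ne', zero_add]
      exact Real.rpow_le_one (norm_nonneg _) (not_lt.1 hx) hp0.le

/-- Logarithmic growth of truncated second moments, for a smooth truncation at scale `1 / t`. -/
theorem IsTailMeasure.tendsto_log_truncated [SecondCountableTopology E] [IsProbabilityMeasure ν]
    (h : IsTailMeasure ν Λ) {k : ℝ → ℝ} (hk : Continuous k) {a b : ℝ} (ha : 0 < a)
    (hka : ∀ u, u ≤ a → k u = 0) (hkb : ∀ u, b ≤ u → k u = 0)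
    {q : E → ℝ} (hq : Continuous q) (hqs : ∀ (s : ℝ) x, q (s • x) = s ^ 2 * q x)
    {A : ℝ} (hqA : ∀ x, |q x| ≤ A * ‖x‖ ^ 2) :
    Tendsto (fun t : ℝ => |Real.log t|⁻¹ *
        ∫ x, q x * ((∫ u in (0)..‖x‖, k u) - ∫ u in (0)..(t * ‖x‖), k u) ∂ν)
      (𝓝[>] 0) (𝓝 (∫ x, q x * (‖x‖ * k ‖x‖) ∂Λ)) := by
  set G : E → ℝ := fun x => q x * (‖x‖ * k ‖x‖) with hG
  have hGc : Continuous G := by fun_prop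
  obtain ⟨B, hB⟩ : ∃ B, ∀ x, |G x| ≤ B := by
    obtain ⟨N, hN⟩ := (isCompact_Icc (a := a) (b := b)).exists_bound_of_continuousOn hk.continuousOn
    refine ⟨|A| * b ^ 2 * (|b| * max N 0), fun x => ?_⟩
    by_cases hx : a ≤ ‖x‖ ∧ ‖x‖ ≤ b
    · have hb : 0 ≤ b := (norm_nonneg x).trans hx.2
      rw [hG, abs_mul, abs_mul, abs_norm]
      gcongr
      · exact (hqA x).trans (by gcongr; exacts [le_abs_self A, hx.2])
      · exact hx.2.trans (le_abs_self b)
      · exact (hN _ hx).trans (le_max_left N 0)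
    · have hk0 : k ‖x‖ = 0 := by
        by_cases hxa : a ≤ ‖x‖
        · exact hkb _ (le_of_not_ge fun hxb => hx ⟨hxa, hxb⟩)
        · exact hka _ (le_of_not_ge hxa)
      simp only [hG, hk0, mul_zero, abs_zero]
      positivity
  have hlim := h G hGc ⟨B, hB⟩ ⟨a, ha, fun x hx => by simp [hG, hka _ hx.le]⟩
  have hcont : Continuous fun s : ℝ => ∫ x, G (s • x) ∂ν := by
    refine continuous_of_dominated (bound := fun _ => B) (fun s => ?_)
      (fun s => Eventually.of_forall fun x => hB _) (integrable_const B)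
      (Eventually.of_forall fun x => by fun_prop)
    exact (hGc.comp (continuous_const_smul s)).measurable.aestronglyMeasurable
  have hΦ : ContinuousOn (fun s : ℝ => (s ^ 2)⁻¹ * ∫ x, G (s • x) ∂ν) (Set.Ioi 0) := by
    refine ContinuousOn.mul (ContinuousOn.inv₀ (by fun_prop) fun s hs => ?_) hcont.continuousOn
    exact (pow_pos (show 0 < s from hs) 2).ne'
  refine (tendsto_log_average hΦ hlim).congr' ?_
  filter_upwards [self_mem_nhdsWithin, Ioo_mem_nhdsGT zero_lt_one] with t ht ht1
  have ht : 0 < t := ht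
  have ht1 : t < 1 := ht1.2
  congr 1
  have hpt : ∀ x : E, q x * ((∫ u in (0)..‖x‖, k u) - ∫ u in (0)..(t * ‖x‖), k u)
      = ∫ s in t..1, (s ^ 3)⁻¹ * G (s • x) := by
    intro x
    rw [intervalIntegral.integral_interval_sub_left (hk.intervalIntegrable _ _)
      (hk.intervalIntegrable _ _)]
    have h1 : ∫ u in (t * ‖x‖)..‖x‖, k u = ∫ s in t..1, ‖x‖ * k (s * ‖x‖) := by
      rw [intervalIntegral.integral_const_mul, intervalIntegral.mul_integral_comp_mul_right,
        one_mul]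
    rw [h1, ← intervalIntegral.integral_const_mul]
    refine intervalIntegral.integral_congr fun s hs => ?_
    have hs0 : 0 < s := lt_of_lt_of_le (lt_min ht one_pos) hs.1
    simp only [hG, hqs, norm_smul, Real.norm_of_nonneg hs0.le]
    field_simp
  simp_rw [hpt]
  rw [← intervalIntegral_integral_swap]
  · refine intervalIntegral.integral_congr fun s hs => ?_
    have hs0 : 0 < s := lt_of_lt_of_le (lt_min ht one_pos) hs.1
    simp only [integral_const_mul]
    field_simp
  · rw [Set.uIoc_of_le ht1.le]
    have hmeas : Measurable (Function.uncurry fun (s : ℝ) (x : E) => (s ^ 3)⁻¹ * G (s • x)) :=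
      (measurable_fst.pow_const 3).inv.mul
        (hGc.comp (continuous_fst.smul continuous_snd)).measurable
    refine Integrable.of_bound (C := (t ^ 3)⁻¹ * B) hmeas.aestronglyMeasurable ?_
    have hfst : ∀ᵐ z ∂((volume.restrict (Set.Ioc t 1)).prod ν), z.1 ∈ Set.Ioc t 1 :=
      Measure.quasiMeasurePreserving_fst.ae (ae_restrict_mem measurableSet_Ioc)
    filter_upwards [hfst] with z hz
    have hz0 : 0 < z.1 := ht.trans hz.1
    simp only [Function.uncurry, norm_mul, norm_inv, norm_pow, Real.norm_of_nonneg hz0.le]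
    gcongr
    · exact hz.1.le
    · exact hB _

end Tail

/-- The cutoff equal to `1` before the support of `k` and to `0` after `b`, with derivative
proportional to `-k`. -/
def primitiveCutoff (k : ℝ → ℝ) (b y : ℝ) : ℝ :=
  1 - (∫ u in (0)..y, k u) / ∫ u in (0)..b, k u

section Cutoff

variable {k : ℝ → ℝ} {a b : ℝ}

theorem continuous_primitiveCutoff (hk : Continuous k) : Continuous (primitiveCutoff k b) :=
  continuous_const.sub
    ((intervalIntegral.continuous_primitive (fun _ _ => hk.intervalIntegrable _ _) 0).div_const _)

theorem primitiveCutoff_eq_one (hka : ∀ u, u ≤ a → k u = 0) {y : ℝ} (hy : 0 ≤ y) (hya : y ≤ a) :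
    primitiveCutoff k b y = 1 := by
  have h0 : ∫ u in (0)..y, k u = 0 := by
    refine intervalIntegral.integral_zero_ae (Eventually.of_forall fun u hu => ?_)
    rw [Set.uIoc_of_le hy] at hu
    exact hka u (hu.2.trans hya)
  simp [primitiveCutoff, h0]

theorem primitiveCutoff_eq_zero (hk : Continuous k) (hkb : ∀ u, b ≤ u → k u = 0)
    (hκ : 0 < ∫ u in (0)..b, k u) {y : ℝ} (hby : b ≤ y) : primitiveCutoff k b y = 0 := by
  have h0 : ∫ u in b..y, k u = 0 := by
    refine intervalIntegral.integral_zero_ae (Eventually.of_forall fun u hu => ?_)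
    rw [Set.uIoc_of_le hby] at hu
    exact hkb u hu.1.le
  rw [primitiveCutoff, ← intervalIntegral.integral_add_adjacent_intervals
    (hk.intervalIntegrable 0 b) (hk.intervalIntegrable b y), h0, add_zero, div_self hκ.ne',
    sub_self]

theorem primitiveCutoff_le_one (hk0 : ∀ u, 0 ≤ k u) (hκ : 0 < ∫ u in (0)..b, k u) {y : ℝ}
    (hy : 0 ≤ y) : primitiveCutoff k b y ≤ 1 :=
  sub_le_self _ (div_nonneg (intervalIntegral.integral_nonneg hy fun u _ => hk0 u) hκ.le)

theorem primitiveCutoff_nonneg (hk : Continuous k) (hk0 : ∀ u, 0 ≤ k u)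
    (hkb : ∀ u, b ≤ u → k u = 0) (hκ : 0 < ∫ u in (0)..b, k u) (y : ℝ) :
    0 ≤ primitiveCutoff k b y := by
  rcases le_total b y with hby | hyb
  · exact (primitiveCutoff_eq_zero hk hkb hκ hby).ge
  · rw [primitiveCutoff, sub_nonneg, div_le_one hκ,
      ← intervalIntegral.integral_add_adjacent_intervals
        (hk.intervalIntegrable 0 y) (hk.intervalIntegrable y b)]
    exact le_add_of_nonneg_right (intervalIntegral.integral_nonneg hyb fun u _ => hk0 u)

theorem abs_mul_primitiveCutoff_le {E : Type*} [NormedAddCommGroup E] {q : E → ℝ} {A : ℝ}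
    (hk : Continuous k) (hk0 : ∀ u, 0 ≤ k u)
    (hkb : ∀ u, b ≤ u → k u = 0) (hκ : 0 < ∫ u in (0)..b, k u)
    (hqA : ∀ x, |q x| ≤ A * ‖x‖ ^ 2) (x : E) :
    |q x * primitiveCutoff k b ‖x‖| ≤ |A| * b ^ 2 := by
  rw [abs_mul, abs_of_nonneg (primitiveCutoff_nonneg hk hk0 hkb hκ _)]
  rcases le_total b ‖x‖ with hb | hb
  · rw [primitiveCutoff_eq_zero hk hkb hκ hb, mul_zero]
    positivity
  · refine (mul_le_of_le_one_right (abs_nonneg _)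
      (primitiveCutoff_le_one hk0 hκ (norm_nonneg x))).trans ((hqA x).trans ?_)
    gcongr
    exact le_abs_self A

theorem norm_sub_cutoff_le {E : Type*} [NormedAddCommGroup E] {q : E → ℝ} {A : ℝ}
    (hk : Continuous k) (hk0 : ∀ u, 0 ≤ k u) (hka : ∀ u, u ≤ a → k u = 0) (hkb : ∀ u, b ≤ u → k u = 0)
    (hκ : 0 < ∫ u in (0)..b, k u) (hqA : ∀ x, |q x| ≤ A * ‖x‖ ^ 2) {f : E → ℂ} {C₀ : ℂ}
    {C p ε r : ℝ} (hp0 : 0 < p) (hgrow : ∀ x, ‖f x‖ ≤ C * ‖x‖ ^ p) (hε : 0 ≤ ε) (hr : 0 < r)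
    (hra : r ≤ a) (hsmall : ∀ x, ‖x‖ ≤ r → ‖f x - C₀ * (q x : ℂ)‖ ≤ ε * ‖x‖ ^ 2) (y : E) :
    ‖f y - C₀ * ((q y * primitiveCutoff k b ‖y‖ : ℝ) : ℂ)‖
      ≤ ε * (‖y‖ ^ 2 * primitiveCutoff k b ‖y‖)
        + (|C| + ‖C₀‖ * (|A| * b ^ 2) / r ^ p) * ({z : E | r < ‖z‖}.indicator norm y) ^ p := by
  by_cases hy : r < ‖y‖
  · rw [Set.indicator_of_mem (show y ∈ {z : E | r < ‖z‖} from hy)]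
    have h1 : ‖C₀ * ((q y * primitiveCutoff k b ‖y‖ : ℝ) : ℂ)‖ ≤ ‖C₀‖ * (|A| * b ^ 2) := by
      rw [norm_mul, Complex.norm_real, Real.norm_eq_abs]
      gcongr
      exact abs_mul_primitiveCutoff_le hk hk0 hkb hκ hqA y
    have h2 : ‖C₀‖ * (|A| * b ^ 2) ≤ ‖C₀‖ * (|A| * b ^ 2) / r ^ p * ‖y‖ ^ p := by
      have hrp : 0 < r ^ p := Real.rpow_pos_of_pos hr p
      rw [div_mul_eq_mul_div, le_div_iff₀ hrp]
      gcongr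
    have h3 : ‖f y‖ ≤ |C| * ‖y‖ ^ p := (hgrow y).trans (by gcongr; exact le_abs_self C)
    have h4 : 0 ≤ ε * (‖y‖ ^ 2 * primitiveCutoff k b ‖y‖) :=
      mul_nonneg hε (mul_nonneg (by positivity) (primitiveCutoff_nonneg hk hk0 hkb hκ _))
    have h5 := norm_sub_le (f y) (C₀ * ((q y * primitiveCutoff k b ‖y‖ : ℝ) : ℂ))
    linarith
  · rw [Set.indicator_of_notMem (show y ∉ {z : E | r < ‖z‖} from hy), Real.zero_rpow hp0.ne',
      primitiveCutoff_eq_one hka (norm_nonneg y) ((not_lt.1 hy).trans hra)]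
    simpa using hsmall y (not_lt.1 hy)

end Cutoff

section Main

variable {E : Type*} [NormedAddCommGroup E] [NormedSpace ℝ E] [MeasurableSpace E] [BorelSpace E]
  {ν Λ : Measure E} [IsProbabilityMeasure ν]
  {k : ℝ → ℝ} {a b : ℝ} {q : E → ℝ} {A : ℝ}

theorem integrable_mul_primitiveCutoff (hk : Continuous k) (hk0 : ∀ u, 0 ≤ k u)
    (hkb : ∀ u, b ≤ u → k u = 0) (hκ : 0 < ∫ u in (0)..b, k u)
    (hq : Continuous q) (hqs : ∀ (s : ℝ) x, q (s • x) = s ^ 2 * q x)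
    (hqA : ∀ x, |q x| ≤ A * ‖x‖ ^ 2) {t : ℝ} (ht : 0 < t) :
    Integrable (fun x => q x * primitiveCutoff k b (t * ‖x‖)) ν := by
  have hcont : Continuous fun x => q x * primitiveCutoff k b (t * ‖x‖) :=
    hq.mul ((continuous_primitiveCutoff hk).comp (continuous_const.mul continuous_norm))
  refine Integrable.of_bound (C := (t ^ 2)⁻¹ * (|A| * b ^ 2))
    hcont.measurable.aestronglyMeasurable (Eventually.of_forall fun x => ?_)
  have h := abs_mul_primitiveCutoff_le hk hk0 hkb hκ hqA (t • x)
  rw [hqs, norm_smul, Real.norm_of_nonneg ht.le, mul_assoc, abs_mul, abs_of_pos (pow_pos ht 2)] at h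
  rwa [Real.norm_eq_abs, le_inv_mul_iff₀ (by positivity)]

theorem tendsto_abs_log_inv : Tendsto (fun t : ℝ => |Real.log t|⁻¹) (𝓝[>] 0) (𝓝 0) :=
  (tendsto_abs_atBot_atTop.comp Real.tendsto_log_nhdsGT_zero).inv_tendsto_atTop

theorem IsTailMeasure.tendsto_log_cutoff [SecondCountableTopology E] (h : IsTailMeasure ν Λ)
    (hk : Continuous k)
    (hk0 : ∀ u, 0 ≤ k u) (ha : 0 < a) (hka : ∀ u, u ≤ a → k u = 0) (hkb : ∀ u, b ≤ u → k u = 0)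
    (hκ : 0 < ∫ u in (0)..b, k u)
    (hq : Continuous q) (hqs : ∀ (s : ℝ) x, q (s • x) = s ^ 2 * q x)
    (hqA : ∀ x, |q x| ≤ A * ‖x‖ ^ 2) :
    Tendsto (fun t : ℝ => |Real.log t|⁻¹ * ∫ x, q x * primitiveCutoff k b (t * ‖x‖) ∂ν)
      (𝓝[>] 0) (𝓝 ((∫ x, q x * (‖x‖ * k ‖x‖) ∂Λ) / ∫ u in (0)..b, k u)) := by
  have h1 := (h.tendsto_log_truncated hk ha hka hkb hq hqs hqA).div_const (∫ u in (0)..b, k u)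
  have h2 := (tendsto_abs_log_inv).mul_const (∫ x, q x * primitiveCutoff k b (1 * ‖x‖) ∂ν)
  have h12 := h1.add h2
  rw [zero_mul, add_zero] at h12
  refine h12.congr' ?_
  filter_upwards [self_mem_nhdsWithin] with t ht
  have ht : 0 < t := ht
  have hi := integrable_mul_primitiveCutoff (ν := ν) hk hk0 hkb hκ hq hqs hqA ht
  have hi1 := integrable_mul_primitiveCutoff (ν := ν) hk hk0 hkb hκ hq hqs hqA one_pos
  have hpt : ∀ x, q x * ((∫ u in (0)..‖x‖, k u) - ∫ u in (0)..(t * ‖x‖), k u)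
      = (∫ u in (0)..b, k u) * (q x * primitiveCutoff k b (t * ‖x‖)
        - q x * primitiveCutoff k b (1 * ‖x‖)) := by
    intro x
    simp only [primitiveCutoff, one_mul]
    field_simp
    ring
  simp_rw [hpt]
  rw [integral_const_mul, integral_sub hi hi1]
  field_simp
  ring

theorem IsTailMeasure.tendsto_log_integral [SecondCountableTopology E] (h : IsTailMeasure ν Λ)
    (hk : Continuous k)
    (hk0 : ∀ u, 0 ≤ k u) (ha : 0 < a) (hka : ∀ u, u ≤ a → k u = 0) (hkb : ∀ u, b ≤ u → k u = 0)
    (hκ : 0 < ∫ u in (0)..b, k u)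
    (hq : Continuous q) (hqs : ∀ (s : ℝ) x, q (s • x) = s ^ 2 * q x)
    (hqA : ∀ x, |q x| ≤ A * ‖x‖ ^ 2) {f : E → ℂ} (hf : Continuous f) {C₀ : ℂ}
    {C p : ℝ} (hp0 : 0 < p) (hp2 : p < 2) (hgrow : ∀ x, ‖f x‖ ≤ C * ‖x‖ ^ p)
    (hsmall : ∀ ε > (0 : ℝ), ∃ r > (0 : ℝ), ∀ x, ‖x‖ ≤ r →
      ‖f x - C₀ * (q x : ℂ)‖ ≤ ε * ‖x‖ ^ 2) :
    Tendsto (fun t : ℝ => (t ^ 2 * |Real.log t|)⁻¹ • ∫ x, f (t • x) ∂ν) (𝓝[>] 0)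
      (𝓝 (C₀ * (((∫ x, q x * (‖x‖ * k ‖x‖) ∂Λ) / ∫ u in (0)..b, k u : ℝ) : ℂ))) := by
  have hT := h.tendsto_log_cutoff hk hk0 ha hka hkb hκ hq hqs hqA
  have hsqs : ∀ (s : ℝ) (x : E), ‖s • x‖ ^ 2 = s ^ 2 * ‖x‖ ^ 2 := fun s x => by
    rw [norm_smul, mul_pow, Real.norm_eq_abs, sq_abs]
  have hsqA : ∀ x : E, |‖x‖ ^ 2| ≤ 1 * ‖x‖ ^ 2 := fun x => by
    rw [abs_of_nonneg (by positivity), one_mul]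
  have hsqc : Continuous fun x : E => ‖x‖ ^ 2 := by fun_prop
  have hT2 := h.tendsto_log_cutoff hk hk0 ha hka hkb hκ hsqc hsqs hsqA
  set J := (∫ x, ‖x‖ ^ 2 * (‖x‖ * k ‖x‖) ∂Λ) / ∫ u in (0)..b, k u
  have hq_int : ∀ t : ℝ, 0 < t →
      Integrable (fun x => q (t • x) * primitiveCutoff k b ‖t • x‖) ν := by
    intro t ht
    refine ((integrable_mul_primitiveCutoff (ν := ν) hk hk0 hkb hκ hq hqs hqA ht).const_mul
      (t ^ 2)).congr (Eventually.of_forall fun x => ?_)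
    simp only [hqs, norm_smul, Real.norm_of_nonneg ht.le, mul_assoc]
  have hmain := (Complex.continuous_ofReal.tendsto _).comp hT |>.const_mul C₀
  have herr : Tendsto (fun t : ℝ => (t ^ 2 * |Real.log t|)⁻¹ •
      ∫ x, (f (t • x) - C₀ * ((q (t • x) * primitiveCutoff k b ‖t • x‖ : ℝ) : ℂ)) ∂ν)
      (𝓝[>] 0) (𝓝 0) := by
    rw [Metric.tendsto_nhds]
    intro ε hε
    set ε' := ε / (2 * (|J| + 1)) with hε'
    have hε'0 : 0 < ε' := by positivity
    obtain ⟨r₀, hr₀, hsm⟩ := hsmall ε' hε'0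
    set r := min r₀ a
    have hr : 0 < r := lt_min hr₀ ha
    obtain ⟨M, hM0, hM⟩ := h.moment_le hp0 hp2 hr
    set M' := |C| + ‖C₀‖ * (|A| * b ^ 2) / r ^ p
    have hlogM : Tendsto (fun t : ℝ => |Real.log t|⁻¹ * (M' * M)) (𝓝[>] 0) (𝓝 0) := by
      simpa using tendsto_abs_log_inv.mul_const (M' * M)
    have hM'0 : 0 ≤ M' := by positivity
    filter_upwards [self_mem_nhdsWithin, Ioo_mem_nhdsGT zero_lt_one,
      hT2.eventually_le_const (lt_of_le_of_lt (le_abs_self J) (lt_add_one |J|)),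
      hlogM.eventually_lt_const (half_pos hε)] with t ht ht1 htJ htM
    have ht : 0 < t := ht
    have hL : 0 < |Real.log t| := abs_pos.2 (Real.log_neg ht ht1.2).ne
    have hi2 := integrable_mul_primitiveCutoff (ν := ν) hk hk0 hkb hκ hsqc hsqs hsqA ht
    obtain ⟨hMi, hMle⟩ := hM t ht
    have hle : ‖∫ x, (f (t • x) - C₀ * ((q (t • x) * primitiveCutoff k b ‖t • x‖ : ℝ) : ℂ)) ∂ν‖
        ≤ ε' * t ^ 2 * (∫ x, ‖x‖ ^ 2 * primitiveCutoff k b (t * ‖x‖) ∂ν) + M' * (M * t ^ 2) := by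
      refine (norm_integral_le_of_norm_le ((hi2.const_mul (ε' * t ^ 2)).add (hMi.const_mul M'))
        (Eventually.of_forall fun x => ?_)).trans ?_
      · refine (norm_sub_cutoff_le hk hk0 hka hkb hκ hqA hp0 hgrow hε'0.le hr (min_le_right _ _)
          (fun x hx => hsm x (hx.trans (min_le_left _ _))) (t • x)).trans (le_of_eq ?_)
        simp only [Pi.add_apply, norm_smul, Real.norm_of_nonneg ht.le]
        ring
      · simp only [Pi.add_apply]
        rw [integral_add (hi2.const_mul _) (hMi.const_mul _), integral_const_mul,
          integral_const_mul]
        gcongr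
    rw [dist_zero_right, norm_smul, Real.norm_of_nonneg (by positivity)]
    calc (t ^ 2 * |Real.log t|)⁻¹ * ‖∫ x, (f (t • x)
            - C₀ * ((q (t • x) * primitiveCutoff k b ‖t • x‖ : ℝ) : ℂ)) ∂ν‖
        ≤ (t ^ 2 * |Real.log t|)⁻¹ * (ε' * t ^ 2 *
          (∫ x, ‖x‖ ^ 2 * primitiveCutoff k b (t * ‖x‖) ∂ν) + M' * (M * t ^ 2)) := by gcongr
      _ = ε' * (|Real.log t|⁻¹ * ∫ x, ‖x‖ ^ 2 * primitiveCutoff k b (t * ‖x‖) ∂ν)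
          + |Real.log t|⁻¹ * (M' * M) := by field_simp
      _ ≤ ε' * (|J| + 1) + |Real.log t|⁻¹ * (M' * M) := by gcongr
      _ < ε / 2 + ε / 2 := by
          refine add_lt_add_of_le_of_lt (le_of_eq ?_) htM
          rw [hε']
          field_simp
      _ = ε := add_halves ε
  have hsum := herr.add hmain
  rw [zero_add] at hsum
  refine hsum.congr' ?_
  filter_upwards [self_mem_nhdsWithin, Ioo_mem_nhdsGT zero_lt_one] with t ht ht1
  have ht : 0 < t := ht
  have hL : |Real.log t| ≠ 0 := (abs_pos.2 (Real.log_neg ht ht1.2).ne).ne'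
  have hLc : ((|Real.log t| : ℝ) : ℂ) ≠ 0 := by exact_mod_cast hL
  have htc : (t : ℂ) ≠ 0 := by exact_mod_cast ht.ne'
  have hqeq : ∫ x, q (t • x) * primitiveCutoff k b ‖t • x‖ ∂ν
      = t ^ 2 * ∫ x, q x * primitiveCutoff k b (t * ‖x‖) ∂ν := by
    rw [← integral_const_mul]
    simp only [hqs, norm_smul, Real.norm_of_nonneg ht.le, mul_assoc]
  have hqi : Integrable
      (fun x => C₀ * ((q (t • x) * primitiveCutoff k b ‖t • x‖ : ℝ) : ℂ)) ν :=
    (hq_int t ht).ofReal.const_mul C₀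
  rw [integral_sub (h.integrable_comp_smul hf hp0 hp2 hgrow ht) hqi, integral_const_mul, integral_complex_ofReal, hqeq]
  simp only [Function.comp_apply, Complex.real_smul]
  push_cast
  field_simp
  ring

end Main

/-- A continuous approximation, as `m → ∞`, of the indicator function of `(1, β]`. -/
def intervalBump (β m u : ℝ) : ℝ :=
  max 0 (min 1 (min (m * (u - 1)) (1 + m * (β - u))))

section Bump

variable {β m u : ℝ}

theorem continuous_intervalBump (β m : ℝ) : Continuous (intervalBump β m) := by
  unfold intervalBump
  fun_prop

theorem intervalBump_nonneg (β m u : ℝ) : 0 ≤ intervalBump β m u := le_max_left _ _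

theorem intervalBump_le_one (β m u : ℝ) : intervalBump β m u ≤ 1 :=
  max_le zero_le_one (min_le_left _ _)

theorem intervalBump_of_le_one (hm : 0 ≤ m) (hu : u ≤ 1) : intervalBump β m u = 0 :=
  max_eq_left ((min_le_right _ _).trans ((min_le_left _ _).trans
    (mul_nonpos_of_nonneg_of_nonpos hm (by linarith))))

theorem intervalBump_of_ge (hm : 1 ≤ m) (hu : β + 1 ≤ u) : intervalBump β m u = 0 :=
  max_eq_left ((min_le_right _ _).trans ((min_le_right _ _).trans (by nlinarith)))

theorem intervalBump_eventuallyEq (β u : ℝ) :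
    ∀ᶠ m in atTop, intervalBump β m u = (Set.Ioc 1 β).indicator 1 u := by
  by_cases hu : u ∈ Set.Ioc 1 β
  · have h1 : 0 < u - 1 := by linarith [hu.1]
    filter_upwards [eventually_ge_atTop (u - 1)⁻¹, eventually_ge_atTop 0] with m hm hm0
    rw [Set.indicator_of_mem hu, Pi.one_apply, intervalBump]
    have h2 : 1 ≤ m * (u - 1) := (inv_le_iff_one_le_mul₀ h1).1 hm
    have h3 : 0 ≤ m * (β - u) := mul_nonneg hm0 (by linarith [hu.2])
    rw [min_eq_left (le_min h2 (by linarith)), max_eq_right zero_le_one]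
  · rw [Set.indicator_of_notMem hu]
    by_cases hu1 : u ≤ 1
    · filter_upwards [eventually_ge_atTop 0] with m hm
      exact intervalBump_of_le_one hm hu1
    · have h1 : 0 < u - β := by
        by_contra hc
        exact hu ⟨not_le.1 hu1, by linarith⟩
      filter_upwards [eventually_ge_atTop (u - β)⁻¹] with m hm
      have h2 : 1 ≤ m * (u - β) := (inv_le_iff_one_le_mul₀ h1).1 hm
      exact max_eq_left ((min_le_right _ _).trans ((min_le_right _ _).trans (by linarith)))

theorem tendsto_intervalBump (β u : ℝ) :
    Tendsto (fun m => intervalBump β m u) atTop (𝓝 ((Set.Ioc 1 β).indicator 1 u)) :=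
  tendsto_const_nhds.congr' ((intervalBump_eventuallyEq β u).mono fun _ h => h.symm)

theorem mul_intervalBump_div (hm : 0 ≤ m) (u : ℝ) :
    u * (intervalBump β m u / max u 1) = intervalBump β m u := by
  rcases le_total u 1 with hu | hu
  · rw [intervalBump_of_le_one hm hu, zero_div, mul_zero]
  · rw [max_eq_left hu, mul_div_cancel₀ _ (by linarith)]

theorem tendsto_integral_intervalBump_div (hβ : 1 < β) :
    Tendsto (fun m => ∫ u in (0)..(β + 1), intervalBump β m u / max u 1) atTop
      (𝓝 (Real.log β)) := by
  have hlim : ∫ u in (0)..(β + 1), (Set.Ioc 1 β).indicator 1 u / max u 1 = Real.log β := by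
    have hcongr : ∀ u : ℝ, (Set.Ioc 1 β).indicator 1 u / max u 1
        = (Set.Ioc 1 β).indicator (fun u : ℝ => u⁻¹) u := by
      intro u
      by_cases hu : u ∈ Set.Ioc 1 β
      · rw [Set.indicator_of_mem hu, Set.indicator_of_mem hu, max_eq_left hu.1.le, Pi.one_apply,
          one_div]
      · rw [Set.indicator_of_notMem hu, Set.indicator_of_notMem hu, zero_div]
    simp_rw [hcongr]
    rw [intervalIntegral.integral_of_le (by linarith), setIntegral_indicator measurableSet_Ioc,
      Set.inter_eq_right.2 (Set.Ioc_subset_Ioc zero_le_one (by linarith)),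
      ← intervalIntegral.integral_of_le hβ.le, integral_inv_of_pos one_pos (by linarith), div_one]
  rw [← hlim]
  refine intervalIntegral.tendsto_integral_filter_of_dominated_convergence (fun _ => 1)
    (Eventually.of_forall fun m => ?_)
    (Eventually.of_forall fun m => Eventually.of_forall fun u _ => ?_)
    intervalIntegrable_const
    (Eventually.of_forall fun u _ => (tendsto_intervalBump β u).div_const _)
  · exact ((continuous_intervalBump β m).measurable.div
      (measurable_id.max measurable_const)).aestronglyMeasurable
  · have h1 : (1 : ℝ) ≤ max u 1 := le_max_right _ _
    rw [Real.norm_of_nonneg (div_nonneg (intervalBump_nonneg _ _ _) (by linarith)),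
      div_le_one (by linarith)]
    exact (intervalBump_le_one _ _ _).trans h1

theorem tendsto_integral_mul_intervalBump {E : Type*} [NormedAddCommGroup E] [MeasurableSpace E]
    [BorelSpace E] {Λ : Measure E} (hΛ : Λ {x : E | 1 ≤ ‖x‖} < ⊤) {q : E → ℝ}
    (hq : Continuous q) {A : ℝ} (hqA : ∀ x, |q x| ≤ A * ‖x‖ ^ 2) (β : ℝ) :
    Tendsto (fun m => ∫ x, q x * (‖x‖ * (intervalBump β m ‖x‖ / max ‖x‖ 1)) ∂Λ) atTop
      (𝓝 (∫ x in {x : E | 1 < ‖x‖ ∧ ‖x‖ ≤ β}, q x ∂Λ)) := by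
  have hS : MeasurableSet {x : E | 1 ≤ ‖x‖} := measurableSet_le measurable_const measurable_norm
  have hS' : MeasurableSet {x : E | 1 < ‖x‖ ∧ ‖x‖ ≤ β} :=
    (measurableSet_lt measurable_const measurable_norm).inter
      (measurableSet_le measurable_norm measurable_const)
  rw [← integral_indicator hS']
  refine tendsto_integral_filter_of_dominated_convergence
    ({x : E | 1 ≤ ‖x‖}.indicator fun _ => |A| * (β + 1) ^ 2) ?_ ?_ ?_ ?_
  · filter_upwards [eventually_ge_atTop 0] with m hm
    simp_rw [mul_intervalBump_div hm]
    exact (hq.mul ((continuous_intervalBump β m).comp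
      continuous_norm)).measurable.aestronglyMeasurable
  · filter_upwards [eventually_ge_atTop 1] with m hm
    refine Eventually.of_forall fun x => ?_
    rw [mul_intervalBump_div (by linarith)]
    by_cases hx : 1 ≤ ‖x‖
    · rw [Set.indicator_of_mem (show x ∈ {x : E | 1 ≤ ‖x‖} from hx)]
      rcases le_total (β + 1) ‖x‖ with hb | hb
      · rw [intervalBump_of_ge hm hb, mul_zero, norm_zero]
        positivity
      · rw [norm_mul, Real.norm_of_nonneg (intervalBump_nonneg _ _ _), Real.norm_eq_abs]
        refine (mul_le_of_le_one_right (abs_nonneg _) (intervalBump_le_one _ _ _)).trans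
          ((hqA x).trans ?_)
        gcongr
        exact le_abs_self A
    · rw [Set.indicator_of_notMem (show x ∉ {x : E | 1 ≤ ‖x‖} from hx),
        intervalBump_of_le_one (by linarith) (not_le.1 hx).le, mul_zero, norm_zero]
  · exact (integrable_indicator_iff hS).2 (integrableOn_const hΛ.ne)
  · refine Eventually.of_forall fun x => ?_
    have hval : {x : E | 1 < ‖x‖ ∧ ‖x‖ ≤ β}.indicator q x
        = q x * (Set.Ioc 1 β).indicator 1 ‖x‖ := by
      by_cases hx : ‖x‖ ∈ Set.Ioc 1 β
      · rw [Set.indicator_of_mem (show x ∈ {x : E | 1 < ‖x‖ ∧ ‖x‖ ≤ β} from hx),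
          Set.indicator_of_mem hx, Pi.one_apply, mul_one]
      · rw [Set.indicator_of_notMem (show x ∉ {x : E | 1 < ‖x‖ ∧ ‖x‖ ≤ β} from hx),
          Set.indicator_of_notMem hx, mul_zero]
    rw [hval]
    refine ((tendsto_intervalBump β ‖x‖).const_mul (q x)).congr' ?_
    filter_upwards [eventually_ge_atTop 0] with m hm
    rw [mul_intervalBump_div hm]

end Bump

theorem IsTailMeasure.tendsto_log_integral_annulus {E : Type*} [NormedAddCommGroup E]
    [NormedSpace ℝ E] [MeasurableSpace E] [BorelSpace E] [SecondCountableTopology E]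
    {ν Λ : Measure E} [IsProbabilityMeasure ν] (h : IsTailMeasure ν Λ)
    (hΛ : Λ {x : E | 1 ≤ ‖x‖} < ⊤) {q : E → ℝ} {A : ℝ}
    (hq : Continuous q) (hqs : ∀ (s : ℝ) x, q (s • x) = s ^ 2 * q x)
    (hqA : ∀ x, |q x| ≤ A * ‖x‖ ^ 2) {f : E → ℂ} (hf : Continuous f) {C₀ : ℂ}
    {C p : ℝ} (hp0 : 0 < p) (hp2 : p < 2) (hgrow : ∀ x, ‖f x‖ ≤ C * ‖x‖ ^ p)
    (hsmall : ∀ ε > (0 : ℝ), ∃ r > (0 : ℝ), ∀ x, ‖x‖ ≤ r →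
      ‖f x - C₀ * (q x : ℂ)‖ ≤ ε * ‖x‖ ^ 2) {β : ℝ} (hβ : 1 < β) :
    Tendsto (fun t : ℝ => (t ^ 2 * |Real.log t|)⁻¹ • ∫ x, f (t • x) ∂ν) (𝓝[>] 0)
      (𝓝 (C₀ * (((∫ x in {x : E | 1 < ‖x‖ ∧ ‖x‖ ≤ β}, q x ∂Λ) / Real.log β : ℝ) : ℂ))) := by
  have hlogβ : 0 < Real.log β := Real.log_pos hβ
  have hκ := tendsto_integral_intervalBump_div hβ
  have hlim : Tendsto (fun m => C₀ *
      (((∫ x, q x * (‖x‖ * (intervalBump β m ‖x‖ / max ‖x‖ 1)) ∂Λ)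
        / ∫ u in (0)..(β + 1), intervalBump β m u / max u 1 : ℝ) : ℂ)) atTop
      (𝓝 (C₀ * (((∫ x in {x : E | 1 < ‖x‖ ∧ ‖x‖ ≤ β}, q x ∂Λ) / Real.log β : ℝ) : ℂ))) :=
    ((Complex.continuous_ofReal.tendsto _).comp
      ((tendsto_integral_mul_intervalBump hΛ hq hqA β).div hκ hlogβ.ne')).const_mul C₀
  have hev : ∀ᶠ m in atTop,
      Tendsto (fun t : ℝ => (t ^ 2 * |Real.log t|)⁻¹ • ∫ x, f (t • x) ∂ν) (𝓝[>] 0)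
        (𝓝 (C₀ * (((∫ x, q x * (‖x‖ * (intervalBump β m ‖x‖ / max ‖x‖ 1)) ∂Λ)
          / ∫ u in (0)..(β + 1), intervalBump β m u / max u 1 : ℝ) : ℂ))) := by
    filter_upwards [hκ.eventually_const_lt hlogβ, eventually_ge_atTop 1] with m hm hm1
    have hkc : Continuous fun u : ℝ => intervalBump β m u / max u 1 :=
      (continuous_intervalBump β m).div (continuous_id.max continuous_const)
        fun u => (lt_of_lt_of_le one_pos (le_max_right u 1)).ne'
    refine h.tendsto_log_integral (a := 1) hkc (fun u => ?_) one_pos (fun u hu => ?_)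
      (fun u hu => ?_) hm hq hqs hqA hf hp0 hp2 hgrow hsmall
    · exact div_nonneg (intervalBump_nonneg _ _ _) (zero_le_one.trans (le_max_right u 1))
    · rw [intervalBump_of_le_one (by linarith) hu, zero_div]
    · rw [intervalBump_of_ge hm1 hu, zero_div]
  obtain ⟨m₀, hm₀⟩ := hev.exists
  have hconst := tendsto_nhds_unique
    (tendsto_const_nhds.congr' (hev.mono fun m hm => tendsto_nhds_unique hm₀ hm)) hlim
  rwa [hconst] at hm₀

theorem isTailMeasure_of_complex {E : Type*} [NormedAddCommGroup E] [NormedSpace ℝ E]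
    [MeasurableSpace E] {ν Λ : Measure E}
    (htail : ∀ f : E → ℂ, Continuous f → (∃ C : ℝ, ∀ x, ‖f x‖ ≤ C) →
      (∃ r > (0 : ℝ), ∀ x, ‖x‖ < r → f x = 0) →
      Tendsto (fun t : ℝ => (t ^ (-2 : ℝ)) • ∫ x, f (t • x) ∂ν) (𝓝[>] 0) (𝓝 (∫ x, f x ∂Λ))) :
    IsTailMeasure ν Λ := by
  rintro g hg ⟨C, hC⟩ ⟨r, hr, hr0⟩
  have h := htail (fun x => (g x : ℂ)) (Complex.continuous_ofReal.comp hg)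
    ⟨C, fun x => by simpa using hC x⟩ ⟨r, hr, fun x hx => by simp [hr0 x hx]⟩
  have hre := (Complex.continuous_re.tendsto _).comp h
  rw [integral_complex_ofReal, Complex.ofReal_re] at hre
  refine hre.congr' ?_
  filter_upwards [self_mem_nhdsWithin] with t ht
  have ht : 0 < t := ht
  simp only [Function.comp_apply, integral_complex_ofReal, Complex.real_smul,
    Complex.re_ofReal_mul, Complex.ofReal_re]
  rw [Real.rpow_neg ht.le, Real.rpow_two]

theorem norm_sub_le_of_tendsto_div_sq {E : Type*} [NormedAddCommGroup E] {e : E → ℂ}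
    (he : Tendsto (fun x => e x / ((‖x‖ ^ 2 : ℝ) : ℂ)) (𝓝[≠] 0) (𝓝 0)) (he0 : e 0 = 0)
    {ε : ℝ} (hε : 0 < ε) : ∃ r > (0 : ℝ), ∀ x, ‖x‖ ≤ r → ‖e x‖ ≤ ε * ‖x‖ ^ 2 := by
  obtain ⟨δ, hδ, h⟩ := Metric.tendsto_nhdsWithin_nhds.1 he ε hε
  refine ⟨δ / 2, by positivity, fun x hx => ?_⟩
  by_cases hx0 : x = 0
  · simp [hx0, he0]
  · have h1 := h (x := x) hx0 (by rw [dist_zero_right]; linarith)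
    have hpos : 0 < ‖x‖ ^ 2 := by positivity
    rw [dist_zero_right, norm_div, Complex.norm_real, Real.norm_of_nonneg hpos.le,
      div_lt_iff₀ hpos] at h1
    exact h1.le

/-- Logarithmic averaging against a measure with tail measure of order `2`:
if `t^{-2} ∫ f(tx) dν → ∫ f dΛ` for bounded continuous `f` vanishing near `0`,
and `f(x) = C₀ ⟨x,v₁⟩⟨x,v₂⟩ + o(|x|²)` at `0` with `|f(x)| ≤ C |x|^{1+η}`, then
`(t² |log t|)⁻¹ ∫ f(tx) dν → (C₀ / log β) ∫_{1<|x|≤β} ⟨x,v₁⟩⟨x,v₂⟩ dΛ` for every `β > 1`,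
the limit being independent of `β`; moreover `Λ` is homogeneous of degree `2`. -/
theorem tendsto_log_averaged_integral {d : ℕ} (hd : 0 < d)
    (ν : Measure (EuclideanSpace ℝ (Fin d))) (hν : IsProbabilityMeasure ν)
    (Λm : Measure (EuclideanSpace ℝ (Fin d)))
    (hΛ0 : Λm {0} = 0)
    (hΛfin : ∀ r : ℝ, 0 < r → Λm {x : EuclideanSpace ℝ (Fin d) | r ≤ ‖x‖} < ⊤)
    (htail : ∀ f : EuclideanSpace ℝ (Fin d) → ℂ, Continuous f →
      (∃ C : ℝ, ∀ x, ‖f x‖ ≤ C) →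
      (∃ r > (0 : ℝ), ∀ x : EuclideanSpace ℝ (Fin d), ‖x‖ < r → f x = 0) →
      Tendsto (fun t : ℝ => (t ^ (-2 : ℝ)) • ∫ x, f (t • x) ∂ν)
        (nhdsWithin 0 (Set.Ioi (0 : ℝ))) (𝓝 (∫ x, f x ∂Λm)))
    (v₁ v₂ : EuclideanSpace ℝ (Fin d)) (C₀ : ℂ)
    (f : EuclideanSpace ℝ (Fin d) → ℂ) (hf : Continuous f)
    (hsmall : Tendsto
      (fun x : EuclideanSpace ℝ (Fin d) =>
        (f x - C₀ * (quadH v₁ v₂ x : ℂ)) / ((‖x‖ ^ 2 : ℝ) : ℂ))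
      (nhdsWithin 0 {(0 : EuclideanSpace ℝ (Fin d))}ᶜ) (𝓝 0))
    (C η : ℝ) (hη0 : 0 < η) (hη1 : η < 1)
    (hgrow : ∀ x : EuclideanSpace ℝ (Fin d), ‖f x‖ ≤ C * ‖x‖ ^ (1 + η)) :
    (∀ β : ℝ, 1 < β →
      Tendsto (fun t : ℝ => ((t ^ 2 * |Real.log t|)⁻¹) • ∫ x, f (t • x) ∂ν)
        (nhdsWithin 0 (Set.Ioi (0 : ℝ)))
        (𝓝 ((C₀ / (Real.log β : ℂ)) *
          ∫ x in {x : EuclideanSpace ℝ (Fin d) | 1 < ‖x‖ ∧ ‖x‖ ≤ β},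
            (quadH v₁ v₂ x : ℂ) ∂Λm))) ∧
    (∀ β₁ β₂ : ℝ, 1 < β₁ → 1 < β₂ →
      (C₀ / (Real.log β₁ : ℂ)) *
          ∫ x in {x : EuclideanSpace ℝ (Fin d) | 1 < ‖x‖ ∧ ‖x‖ ≤ β₁},
            (quadH v₁ v₂ x : ℂ) ∂Λm =
        (C₀ / (Real.log β₂ : ℂ)) *
          ∫ x in {x : EuclideanSpace ℝ (Fin d) | 1 < ‖x‖ ∧ ‖x‖ ≤ β₂},
            (quadH v₁ v₂ x : ℂ) ∂Λm) ∧
    (∀ s : ℝ, 0 < s → ∀ g : EuclideanSpace ℝ (Fin d) → ℂ, Continuous g →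
      (∃ C' : ℝ, ∀ x, ‖g x‖ ≤ C') →
      (∃ r > (0 : ℝ), ∀ x : EuclideanSpace ℝ (Fin d), ‖x‖ < r → g x = 0) →
      ∫ x, g (s • x) ∂Λm = (s ^ 2 : ℝ) • ∫ x, g x ∂Λm) := by
  have h := isTailMeasure_of_complex htail
  have hq : Continuous (quadH v₁ v₂) := by
    unfold quadH
    fun_prop
  have hqs : ∀ (s : ℝ) x, quadH v₁ v₂ (s • x) = s ^ 2 * quadH v₁ v₂ x := by
    intro s x
    simp only [quadH, real_inner_smul_left]
    ring
  have hqA : ∀ x, |quadH v₁ v₂ x| ≤ ‖v₁‖ * ‖v₂‖ * ‖x‖ ^ 2 := by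
    intro x
    calc |quadH v₁ v₂ x| = |⟪x, v₁⟫_ℝ| * |⟪x, v₂⟫_ℝ| := abs_mul _ _
      _ ≤ (‖x‖ * ‖v₁‖) * (‖x‖ * ‖v₂‖) := by
        gcongr <;> exact abs_real_inner_le_norm _ _
      _ = ‖v₁‖ * ‖v₂‖ * ‖x‖ ^ 2 := by ring
  have hf0 : f 0 = 0 := by
    have h0 := hgrow 0
    rw [norm_zero, Real.zero_rpow (by linarith), mul_zero] at h0
    exact norm_le_zero_iff.1 h0
  have hsmall' : ∀ ε > (0 : ℝ), ∃ r > (0 : ℝ), ∀ x, ‖x‖ ≤ r →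
      ‖f x - C₀ * (quadH v₁ v₂ x : ℂ)‖ ≤ ε * ‖x‖ ^ 2 := fun ε hε =>
    norm_sub_le_of_tendsto_div_sq hsmall (by simp [hf0, quadH]) hε
  have hlim : ∀ β : ℝ, 1 < β →
      Tendsto (fun t : ℝ => ((t ^ 2 * |Real.log t|)⁻¹) • ∫ x, f (t • x) ∂ν)
        (𝓝[>] 0) (𝓝 ((C₀ / (Real.log β : ℂ)) *
          ∫ x in {x : EuclideanSpace ℝ (Fin d) | 1 < ‖x‖ ∧ ‖x‖ ≤ β},
            (quadH v₁ v₂ x : ℂ) ∂Λm)) := by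
    intro β hβ
    have hmain := h.tendsto_log_integral_annulus (hΛfin 1 one_pos) hq hqs hqA hf
      (by linarith) (by linarith) hgrow hsmall' hβ
    rwa [Complex.ofReal_div, mul_div_left_comm, mul_comm, ← integral_complex_ofReal] at hmain
  refine ⟨hlim, fun β₁ β₂ h₁ h₂ => tendsto_nhds_unique (hlim β₁ h₁) (hlim β₂ h₂), ?_⟩
  rintro s hs g hg ⟨C', hC'⟩ ⟨r, hr, hr0⟩
  have hscaled := htail (fun x => g (s • x)) (hg.comp (continuous_const_smul s))
    ⟨C', fun x => hC' _⟩ ⟨r / s, by positivity, fun x hx => hr0 _ (by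
      rwa [norm_smul, Real.norm_of_nonneg hs.le, mul_comm, ← lt_div_iff₀ hs])⟩
  have hmul : Tendsto (fun t : ℝ => s * t) (𝓝[>] 0) (𝓝[>] 0) := by
    refine tendsto_nhdsWithin_iff.2 ⟨?_, ?_⟩
    · have : Tendsto (fun t : ℝ => s * t) (𝓝 0) (𝓝 (s * 0)) :=
        (continuous_const.mul continuous_id).tendsto 0
      rw [mul_zero] at this
      exact this.mono_left nhdsWithin_le_nhds
    · filter_upwards [self_mem_nhdsWithin] with t ht
      exact mul_pos hs ht
  have hcomp := ((htail g hg ⟨C', hC'⟩ ⟨r, hr, hr0⟩).comp hmul).const_smul (s ^ 2 : ℝ)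
  refine tendsto_nhds_unique hscaled (hcomp.congr' ?_)
  filter_upwards [self_mem_nhdsWithin] with t ht
  have ht : 0 < t := ht
  simp only [Function.comp_apply, smul_smul]
  rw [Real.mul_rpow hs.le ht.le, Real.rpow_neg hs.le, Real.rpow_two, mul_inv_cancel_left₀
    (by positivity)]
end
end

section
/- Let G = { g ∈ GL(ℝ^d) : |gx| = |g|·|x| for all x ∈ ℝ^d } be the similarity group of ℝ^d, and let G₁ ⊆ G be a closed subgroup that is not compact. Then the set {|g| : g ∈ G₁} is either equal to all of (0,∞), or equal to { p^n : n ∈ ℤ } for some real p > 1. Moreover, there exists z ∈ G₁ with |z| > 1 such that z·g = g·z for every g ∈ G₁. -/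
open MeasureTheory Filter Topology

noncomputable section

/-- `Euc d` is the Euclidean space `ℝ^d`. -/
abbrev Euc (d : ℕ) : Type := EuclideanSpace ℝ (Fin d)

/-- The space of continuous linear endomorphisms of `ℝ^d`, with the operator norm. -/
abbrev EndV (d : ℕ) : Type := Euc d →L[ℝ] Euc d

section SimilarityGroups

theorem norm_mul_of_similarity {E : Type*} [NormedAddCommGroup E] [NormedSpace ℝ E]
    [Nontrivial E] {A B : E →L[ℝ] E} (hA : ∀ x, ‖A x‖ = ‖A‖ * ‖x‖) (hB : ∀ x, ‖B x‖ = ‖B‖ * ‖x‖) :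
    ‖A * B‖ = ‖A‖ * ‖B‖ := by
  obtain ⟨x, hx⟩ := exists_ne (0 : E)
  refine le_antisymm (norm_mul_le A B) (le_of_mul_le_mul_right ?_ (norm_pos_iff.2 hx))
  rw [mul_assoc, ← hB, ← hA]
  exact (A * B).le_opNorm x

theorem norm_inv_of_similarity {E : Type*} [NormedAddCommGroup E] [NormedSpace ℝ E]
    [Nontrivial E] {g : (E →L[ℝ] E)ˣ}
    (hg : ∀ x, ‖(g : E →L[ℝ] E) x‖ = ‖(g : E →L[ℝ] E)‖ * ‖x‖)
    (hg' : ∀ x, ‖((g⁻¹ : (E →L[ℝ] E)ˣ) : E →L[ℝ] E) x‖ =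
      ‖((g⁻¹ : (E →L[ℝ] E)ˣ) : E →L[ℝ] E)‖ * ‖x‖) :
    ‖((g⁻¹ : (E →L[ℝ] E)ˣ) : E →L[ℝ] E)‖ = ‖(g : E →L[ℝ] E)‖⁻¹ := by
  refine eq_inv_of_mul_eq_one_right ?_
  rw [← norm_mul_of_similarity hg hg', Units.mul_inv, norm_one]

variable {E : Type*} [NormedAddCommGroup E] [InnerProductSpace ℝ E] [FiniteDimensional ℝ E]

/-- The trace, as a continuous linear functional on the endomorphisms of `E`. -/
def traceCLM (E : Type*) [NormedAddCommGroup E] [InnerProductSpace ℝ E]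
    [FiniteDimensional ℝ E] : (E →L[ℝ] E) →L[ℝ] ℝ :=
  LinearMap.toContinuousLinearMap (LinearMap.trace ℝ E ∘ₗ ContinuousLinearMap.coeLM ℝ)

theorem traceCLM_apply (A : E →L[ℝ] E) :
    traceCLM E A = LinearMap.trace ℝ E (A : E →ₗ[ℝ] E) := rfl

theorem traceCLM_mul_comm (A B : E →L[ℝ] E) : traceCLM E (A * B) = traceCLM E (B * A) :=
  LinearMap.trace_mul_comm ℝ (A : E →ₗ[ℝ] E) (B : E →ₗ[ℝ] E)

theorem traceCLM_star (A : E →L[ℝ] E) : traceCLM E (star A) = traceCLM E A := by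
  simp only [traceCLM_apply, LinearMap.trace_eq_sum_inner _ (stdOrthonormalBasis ℝ E)]
  refine Finset.sum_congr rfl fun i _ => ?_
  rw [ContinuousLinearMap.star_eq_adjoint, ContinuousLinearMap.coe_coe,
    ContinuousLinearMap.adjoint_inner_right, real_inner_comm, ContinuousLinearMap.coe_coe]

/-- The operator norm is at most the Hilbert–Schmidt norm. -/
theorem sq_norm_le_traceCLM_star_mul_self (A : E →L[ℝ] E) :
    ‖A‖ ^ 2 ≤ traceCLM E (star A * A) := by
  let b := stdOrthonormalBasis ℝ E
  have htr : traceCLM E (star A * A) = ∑ i, ‖star A (b i)‖ ^ 2 := by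
    rw [traceCLM_mul_comm, traceCLM_apply, LinearMap.trace_eq_sum_inner _ b]
    refine Finset.sum_congr rfl fun i _ => ?_
    rw [ContinuousLinearMap.coe_coe, mul_apply_eq_comp,
      ← ContinuousLinearMap.adjoint_inner_left, ← ContinuousLinearMap.star_eq_adjoint,
      real_inner_self_eq_norm_sq]
  have hnonneg : 0 ≤ traceCLM E (star A * A) := by
    rw [htr]; positivity
  refine (Real.le_sqrt (norm_nonneg _) hnonneg).1 ?_
  refine A.opNorm_le_bound (Real.sqrt_nonneg _) fun x => ?_
  refine (sq_le_sq₀ (norm_nonneg _) (by positivity)).1 ?_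
  rw [mul_pow, Real.sq_sqrt hnonneg, htr, ← b.sum_sq_norm_inner_right (A x), Finset.sum_mul]
  refine Finset.sum_le_sum fun i _ => ?_
  rw [← mul_pow, ← ContinuousLinearMap.adjoint_inner_left, ← ContinuousLinearMap.star_eq_adjoint]
  gcongr
  exact norm_inner_le_norm _ _

theorem sq_norm_sub_one_le_of_star_mul_self {v : E →L[ℝ] E} (hv : star v * v = 1) :
    ‖v - 1‖ ^ 2 ≤ 2 * (traceCLM E 1 - traceCLM E v) := by
  refine (sq_norm_le_traceCLM_star_mul_self _).trans_eq ?_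
  have : star (v - 1) * (v - 1) = 1 - star v - v + 1 := by
    rw [star_sub, star_one, sub_mul, mul_sub, hv]; noncomm_ring
  rw [this, map_add, map_sub, map_sub, traceCLM_star]
  ring

/-- If orthogonal operators `v n` tend in trace to the identity, they tend to the identity. -/
theorem tendsto_one_of_tendsto_traceCLM {v : ℕ → E →L[ℝ] E} (hv : ∀ n, star (v n) * v n = 1)
    (h : Tendsto (fun n => traceCLM E (v n)) atTop (𝓝 (traceCLM E 1))) :
    Tendsto v atTop (𝓝 1) := by
  rw [tendsto_iff_norm_sub_tendsto_zero]
  have h0 : Tendsto (fun n => √(2 * (traceCLM E 1 - traceCLM E (v n)))) atTop (𝓝 0) := by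
    have := ((h.const_sub (traceCLM E 1)).const_mul 2).sqrt
    simpa using this
  exact squeeze_zero (fun _ => norm_nonneg _)
    (fun n => Real.le_sqrt_of_sq_le (sq_norm_sub_one_le_of_star_mul_self (hv n))) h0

theorem norm_le_one_of_star_mul_self {v : E →L[ℝ] E} (hv : star v * v = 1) : ‖v‖ ≤ 1 := by
  refine v.opNorm_le_bound zero_le_one fun x => ?_
  rw [v.norm_map_iff_adjoint_comp_self.2 hv x, one_mul]

/-- Uniqueness of nearest points near the identity, in sequential form: if `k n ≠ 1` are orthogonal
and tend to `1`, and `v n` tend to `1`, then `v n` and `v n * k n` cannot both maximize the trace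
among their translates by the `k m` and their inverses. -/
theorem not_forall_traceCLM_mul_le {v k : ℕ → E →L[ℝ] E} (hk : ∀ n, star (k n) * k n = 1)
    (hne : ∀ n, k n ≠ 1) (hv1 : Tendsto v atTop (𝓝 1)) (hk1 : Tendsto k atTop (𝓝 1))
    (hv : ∀ n m, traceCLM E (v n * k m) ≤ traceCLM E (v n))
    (hv' : ∀ n m, traceCLM E (v n * star (k m)) ≤ traceCLM E (v n))
    (hvk : ∀ n m, traceCLM E (v n * k n * k m) ≤ traceCLM E (v n * k n))
    (hvk' : ∀ n m, traceCLM E (v n * k n * star (k m)) ≤ traceCLM E (v n * k n)) : False := by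
  have hpos : ∀ n, 0 < ‖k n - 1‖ := fun n => norm_pos_iff.2 (sub_ne_zero.2 (hne n))
  let w : ℕ → E →L[ℝ] E := fun n => ‖k n - 1‖⁻¹ • (k n - 1)
  have hw : ∀ n, w n ∈ Metric.sphere (0 : E →L[ℝ] E) 1 := fun n => by
    rw [mem_sphere_zero_iff_norm, norm_smul, norm_inv, norm_norm, inv_mul_cancel₀ (hpos n).ne']
  obtain ⟨X, hX, φ, hφ, hlim⟩ := (isCompact_sphere (0 : E →L[ℝ] E) 1).tendsto_subseq hw
  have hk1φ := hk1.comp hφ.tendsto_atTop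
  have hskew : star X = -X := by
    have h1 : Tendsto (fun n => star (w (φ n))) atTop (𝓝 (star X)) := hlim.star
    have h2 : Tendsto (fun n => -(star (k (φ n)) * w (φ n))) atTop (𝓝 (-(star 1 * X))) :=
      (hk1φ.star.mul hlim).neg
    rw [star_one, one_mul] at h2
    refine tendsto_nhds_unique h1 (h2.congr fun n => ?_)
    simp only [w, star_smul, star_sub, star_one, mul_smul_comm, mul_sub, hk, mul_one, star_trivial,
      ← smul_neg, neg_sub]
  have hzero : ∀ u : E →L[ℝ] E, (∀ m, traceCLM E (u * k m) ≤ traceCLM E u) →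
      (∀ m, traceCLM E (u * star (k m)) ≤ traceCLM E u) → traceCLM E (u * X) = 0 := by
    intro u hu hu'
    have h1 : Tendsto (fun n => traceCLM E (u * w (φ n))) atTop (𝓝 (traceCLM E (u * X))) :=
      ((traceCLM E).continuous.tendsto _).comp (hlim.const_mul u)
    have h2 : Tendsto (fun n => traceCLM E (u * star (w (φ n)))) atTop
        (𝓝 (traceCLM E (u * star X))) :=
      ((traceCLM E).continuous.tendsto _).comp (hlim.star.const_mul u)
    rw [hskew, mul_neg, map_neg] at h2
    refine le_antisymm (le_of_tendsto' h1 fun n => ?_)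
      (neg_nonpos.1 (le_of_tendsto' h2 fun n => ?_))
    · have hun : u * w (φ n) = ‖k (φ n) - 1‖⁻¹ • (u * k (φ n) - u) := by
        simp only [w, mul_smul_comm, mul_sub, mul_one]
      rw [hun, map_smul, map_sub]
      exact mul_nonpos_of_nonneg_of_nonpos (inv_pos.2 (hpos _)).le (sub_nonpos.2 (hu _))
    · have hun : u * star (w (φ n)) = ‖k (φ n) - 1‖⁻¹ • (u * star (k (φ n)) - u) := by
        simp only [w, star_smul, star_sub, star_one, star_trivial, mul_smul_comm, mul_sub, mul_one]
      rw [hun, map_smul, map_sub]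
      exact mul_nonpos_of_nonneg_of_nonpos (inv_pos.2 (hpos _)).le (sub_nonpos.2 (hu' _))
  have hvw : ∀ n, traceCLM E (v n * w n * X) = 0 := by
    intro n
    have h1 := hzero (v n) (hv n) (hv' n)
    have h2 := hzero (v n * k n) (hvk n) (hvk' n)
    simp only [w, mul_smul_comm, smul_mul_assoc, mul_sub, sub_mul, mul_one, map_smul, map_sub,
      h1, h2, sub_zero, smul_zero]
  have hXX : traceCLM E (X * X) = 0 := by
    have h1 : Tendsto (fun n => traceCLM E (v (φ n) * w (φ n) * X)) atTop
        (𝓝 (traceCLM E (1 * X * X))) :=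
      ((traceCLM E).continuous.tendsto _).comp
        (((hv1.comp hφ.tendsto_atTop).mul hlim).mul_const X)
    simp only [hvw, one_mul] at h1
    exact tendsto_nhds_unique h1 tendsto_const_nhds
  have hle := sq_norm_le_traceCLM_star_mul_self X
  rw [hskew, neg_mul, map_neg, hXX, mem_sphere_zero_iff_norm.1 hX] at hle
  norm_num at hle

/-- Positive powers of an orthogonal operator accumulate at the identity. -/
theorem exists_pow_tendsto_one {u : E →L[ℝ] E} (hu : star u * u = 1) :
    ∃ N : ℕ → ℕ, (∀ j, 0 < N j) ∧ Tendsto (fun j => u ^ N j) atTop (𝓝 1) := by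
  have hpow : ∀ n, star (u ^ n) * u ^ n = 1 := by
    intro n
    induction n with
    | zero => simp
    | succ n ih =>
      rw [pow_succ', star_mul, mul_assoc, ← mul_assoc (star u), hu, one_mul, ih]
  obtain ⟨L, -, φ, hφ, hlim⟩ := (isCompact_closedBall (0 : E →L[ℝ] E) 1).tendsto_subseq
    (x := fun n => u ^ n)
    (fun n => mem_closedBall_zero_iff.2 (norm_le_one_of_star_mul_self (hpow n)))
  have hL : star L * L = 1 :=
    tendsto_nhds_unique (hlim.star.mul hlim)
      (tendsto_const_nhds.congr fun n => (hpow (φ n)).symm)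
  have hlt : ∀ j, φ j < φ (j + 1) := fun j => hφ (Nat.lt_succ_self j)
  refine ⟨fun j => φ (j + 1) - φ j, fun j => Nat.sub_pos_of_lt (hlt j), ?_⟩
  have h := hlim.star.mul (hlim.comp (tendsto_add_atTop_nat 1))
  rw [hL] at h
  refine h.congr fun j => ?_
  have : φ (j + 1) = φ j + (φ (j + 1) - φ j) := (Nat.add_sub_of_le (hlt j).le).symm
  simp only [Function.comp_apply]
  conv_lhs => rw [this, pow_add, ← mul_assoc, hpow, one_mul]

theorem star_mul_self_normalize {A : E →L[ℝ] E} (hA : ∀ x, ‖A x‖ = ‖A‖ * ‖x‖) (h0 : A ≠ 0) :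
    star (‖A‖⁻¹ • A) * (‖A‖⁻¹ • A) = 1 := by
  refine (ContinuousLinearMap.norm_map_iff_adjoint_comp_self _).1 fun x => ?_
  rw [smul_apply, norm_smul, hA, norm_inv, norm_norm,
    inv_mul_cancel_left₀ (norm_ne_zero_iff.2 h0)]

variable [Nontrivial E]

theorem isCompact_setOf_norm_mem_Icc {G : Subgroup (E →L[ℝ] E)ˣ}
    (hsim : ∀ g ∈ G, ∀ x : E, ‖(g : E →L[ℝ] E) x‖ = ‖(g : E →L[ℝ] E)‖ * ‖x‖)
    (hclosed : IsClosed (G : Set (E →L[ℝ] E)ˣ)) {a : ℝ} (ha : 0 < a) (b : ℝ) :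
    IsCompact {g : (E →L[ℝ] E)ˣ | g ∈ G ∧ ‖(g : E →L[ℝ] E)‖ ∈ Set.Icc a b} := by
  have hK : IsCompact (Metric.closedBall (0 : E →L[ℝ] E) b ×ˢ
      (MulOpposite.unop ⁻¹' Metric.closedBall (0 : E →L[ℝ] E) a⁻¹)) :=
    (isCompact_closedBall _ _).prod
      (MulOpposite.opHomeomorph.symm.isClosedEmbedding.isCompact_preimage
        (isCompact_closedBall _ _))
  refine (Units.isClosedEmbedding_embedProduct.isCompact_preimage hK).of_isClosed_subset ?_ ?_
  · exact hclosed.inter (isClosed_Icc.preimage Units.continuous_val.norm)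
  · rintro g ⟨hg, hga, hgb⟩
    refine ⟨mem_closedBall_zero_iff.2 hgb, mem_closedBall_zero_iff.2 ?_⟩
    change ‖((g⁻¹ : (E →L[ℝ] E)ˣ) : E →L[ℝ] E)‖ ≤ a⁻¹
    rw [norm_inv_of_similarity (hsim g hg) (hsim _ (inv_mem hg))]
    exact inv_anti₀ ha hga

theorem exists_one_lt_norm_of_not_isCompact {G : Subgroup (E →L[ℝ] E)ˣ}
    (hsim : ∀ g ∈ G, ∀ x : E, ‖(g : E →L[ℝ] E) x‖ = ‖(g : E →L[ℝ] E)‖ * ‖x‖)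
    (hclosed : IsClosed (G : Set (E →L[ℝ] E)ˣ)) (hnc : ¬ IsCompact (G : Set (E →L[ℝ] E)ˣ)) :
    ∃ g ∈ G, 1 < ‖(g : E →L[ℝ] E)‖ := by
  by_contra! hle
  refine hnc ?_
  convert isCompact_setOf_norm_mem_Icc hsim hclosed one_pos 1 using 1
  ext g
  refine ⟨fun hg => ⟨hg, ?_, hle g hg⟩, fun h => h.1⟩
  have hinv := hle _ (inv_mem hg)
  rwa [norm_inv_of_similarity (hsim g hg) (hsim _ (inv_mem hg)),
    inv_le_one₀ (Units.norm_pos g)] at hinv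

/-- The logarithms of the norms of a group of similarities. -/
def logNorms (G : Subgroup (E →L[ℝ] E)ˣ)
    (hsim : ∀ g ∈ G, ∀ x : E, ‖(g : E →L[ℝ] E) x‖ = ‖(g : E →L[ℝ] E)‖ * ‖x‖) :
    AddSubgroup ℝ where
  carrier := {t | ∃ g ∈ G, ‖(g : E →L[ℝ] E)‖ = Real.exp t}
  zero_mem' := ⟨1, one_mem G, by simp⟩
  add_mem' := by
    rintro s t ⟨g, hg, hgs⟩ ⟨h, hh, hht⟩
    refine ⟨g * h, mul_mem hg hh, ?_⟩
    rw [Units.val_mul, norm_mul_of_similarity (hsim g hg) (hsim h hh), hgs, hht, Real.exp_add]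
  neg_mem' := by
    rintro t ⟨g, hg, hgt⟩
    refine ⟨g⁻¹, inv_mem hg, ?_⟩
    rw [norm_inv_of_similarity (hsim g hg) (hsim _ (inv_mem hg)), hgt, Real.exp_neg]

theorem isClosed_logNorms {G : Subgroup (E →L[ℝ] E)ˣ}
    (hsim : ∀ g ∈ G, ∀ x : E, ‖(g : E →L[ℝ] E) x‖ = ‖(g : E →L[ℝ] E)‖ * ‖x‖)
    (hclosed : IsClosed (G : Set (E →L[ℝ] E)ˣ)) : IsClosed (logNorms G hsim : Set ℝ) := by
  refine isClosed_of_closure_subset fun t ht => ?_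
  obtain ⟨s, hs, hst⟩ := mem_closure_iff_seq_limit.1 ht
  have hK := (isCompact_setOf_norm_mem_Icc hsim hclosed (Real.exp_pos (t - 1))
    (Real.exp (t + 1))).image Units.continuous_val.norm
  have hexp : Tendsto (fun n => Real.exp (s n)) atTop (𝓝 (Real.exp t)) :=
    (Real.continuous_exp.tendsto t).comp hst
  have hmem := hK.isClosed.mem_of_tendsto hexp (by
    filter_upwards [hst (Icc_mem_nhds (sub_one_lt t) (lt_add_one t))] with n hn
    obtain ⟨g, hg, hgn⟩ := hs n
    refine ⟨g, ⟨hg, ?_⟩, hgn⟩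
    rw [hgn]
    exact ⟨Real.exp_le_exp.2 hn.1, Real.exp_le_exp.2 hn.2⟩)
  obtain ⟨g, hg, hgt⟩ := hmem
  exact ⟨g, hg.1, hgt⟩

theorem norms_eq_Ioi_or_eq_zpowers {G : Subgroup (E →L[ℝ] E)ˣ}
    (hsim : ∀ g ∈ G, ∀ x : E, ‖(g : E →L[ℝ] E) x‖ = ‖(g : E →L[ℝ] E)‖ * ‖x‖)
    (hclosed : IsClosed (G : Set (E →L[ℝ] E)ˣ)) (hnc : ¬ IsCompact (G : Set (E →L[ℝ] E)ˣ)) :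
    {r : ℝ | ∃ g ∈ G, r = ‖(g : E →L[ℝ] E)‖} = Set.Ioi (0 : ℝ) ∨
      ∃ p : ℝ, 1 < p ∧
        {r : ℝ | ∃ g ∈ G, r = ‖(g : E →L[ℝ] E)‖} = {r : ℝ | ∃ n : ℤ, r = p ^ n} := by
  rcases (logNorms G hsim).dense_or_cyclic with hd | ⟨a, ha⟩
  · left
    have huniv : (logNorms G hsim : Set ℝ) = Set.univ := by
      rw [← (isClosed_logNorms hsim hclosed).closure_eq, hd.closure_eq]
    ext r
    refine ⟨?_, fun hr => ?_⟩
    · rintro ⟨g, -, rfl⟩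
      exact Units.norm_pos g
    · obtain ⟨g, hg, hgr⟩ : Real.log r ∈ (logNorms G hsim : Set ℝ) := huniv ▸ Set.mem_univ _
      exact ⟨g, hg, by rw [hgr, Real.exp_log hr]⟩
  · right
    rw [← AddSubgroup.zmultiples_eq_closure] at ha
    have ha' : logNorms G hsim = AddSubgroup.zmultiples |a| := by
      rcases abs_choice a with h | h
      · rw [h, ha]
      · rw [h, ha, AddSubgroup.zmultiples_neg]
    have ha0 : a ≠ 0 := by
      rintro rfl
      obtain ⟨g, hg, hg1⟩ := exists_one_lt_norm_of_not_isCompact hsim hclosed hnc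
      have hmem : Real.log ‖(g : E →L[ℝ] E)‖ ∈ logNorms G hsim :=
        ⟨g, hg, (Real.exp_log (Units.norm_pos g)).symm⟩
      rw [ha, AddSubgroup.zmultiples_zero_eq_bot, AddSubgroup.mem_bot] at hmem
      exact (Real.log_pos hg1).ne' hmem
    refine ⟨Real.exp |a|, Real.one_lt_exp_iff.2 (abs_pos.2 ha0), ?_⟩
    ext r
    constructor
    · rintro ⟨g, hg, rfl⟩
      have hmem : Real.log ‖(g : E →L[ℝ] E)‖ ∈ logNorms G hsim :=
        ⟨g, hg, (Real.exp_log (Units.norm_pos g)).symm⟩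
      rw [ha', AddSubgroup.mem_zmultiples_iff] at hmem
      obtain ⟨n, hn⟩ := hmem
      refine ⟨n, ?_⟩
      rw [← Real.rpow_intCast, ← Real.exp_mul, mul_comm, ← zsmul_eq_mul, hn,
        Real.exp_log (Units.norm_pos g)]
    · rintro ⟨n, rfl⟩
      have hmem : n • |a| ∈ logNorms G hsim := ha' ▸ AddSubgroup.zsmul_mem_zmultiples |a| n
      obtain ⟨g, hg, hgn⟩ := hmem
      exact ⟨g, hg, by rw [hgn, ← Real.rpow_intCast, ← Real.exp_mul, mul_comm, zsmul_eq_mul]⟩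

/-- A unique trace maximizer on a norm level set of a group of similarities is central. -/
theorem commute_of_unique_traceCLM_max {G : Subgroup (E →L[ℝ] E)ˣ}
    (hsim : ∀ g ∈ G, ∀ x : E, ‖(g : E →L[ℝ] E) x‖ = ‖(g : E →L[ℝ] E)‖ * ‖x‖)
    {z : (E →L[ℝ] E)ˣ} (hz : z ∈ G)
    (huniq : ∀ y ∈ G, ‖(y : E →L[ℝ] E)‖ = ‖(z : E →L[ℝ] E)‖ →
      traceCLM E y = traceCLM E z → y = z) {g : (E →L[ℝ] E)ˣ} (hg : g ∈ G) :
    z * g = g * z := by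
  have h := huniq (g * z * g⁻¹) (mul_mem (mul_mem hg hz) (inv_mem hg)) ?_ ?_
  · exact (mul_inv_eq_iff_eq_mul.1 h).symm
  · rw [Units.val_mul, norm_mul_of_similarity (hsim _ (mul_mem hg hz)) (hsim _ (inv_mem hg)),
      Units.val_mul, norm_mul_of_similarity (hsim g hg) (hsim z hz),
      norm_inv_of_similarity (hsim g hg) (hsim _ (inv_mem hg)), mul_right_comm,
      mul_inv_cancel₀ (Units.norm_pos g).ne', one_mul]
  · rw [Units.val_mul, traceCLM_mul_comm, ← Units.val_mul, ← mul_assoc, inv_mul_cancel, one_mul]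

/-- If no element of norm `r` is central, the trace has two distinct maximizers on the level set of
norm `r`. -/
theorem exists_ne_traceCLM_max {G : Subgroup (E →L[ℝ] E)ˣ}
    (hsim : ∀ g ∈ G, ∀ x : E, ‖(g : E →L[ℝ] E) x‖ = ‖(g : E →L[ℝ] E)‖ * ‖x‖)
    (hclosed : IsClosed (G : Set (E →L[ℝ] E)ˣ)) {r : ℝ} (hr : 0 < r)
    (hne : ∃ g ∈ G, ‖(g : E →L[ℝ] E)‖ = r)
    (hcon : ∀ z ∈ G, ‖(z : E →L[ℝ] E)‖ = r → ∃ g ∈ G, z * g ≠ g * z) :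
    ∃ z ∈ G, ∃ y ∈ G, ‖(z : E →L[ℝ] E)‖ = r ∧ ‖(y : E →L[ℝ] E)‖ = r ∧
      y ≠ z ∧ traceCLM E y = traceCLM E z ∧
      ∀ x ∈ G, ‖(x : E →L[ℝ] E)‖ = r → traceCLM E x ≤ traceCLM E z := by
  have hcpt := isCompact_setOf_norm_mem_Icc hsim hclosed hr r
  simp only [Set.Icc_self, Set.mem_singleton_iff] at hcpt
  obtain ⟨z, ⟨hz, hzn⟩, hmax⟩ := hcpt.exists_isMaxOn hne
    ((traceCLM E).continuous.comp Units.continuous_val).continuousOn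
  obtain ⟨h, hh, hzh⟩ := hcon z hz hzn
  by_contra hall
  refine hzh (commute_of_unique_traceCLM_max hsim hz (fun y hy hyn hyt => ?_) hh)
  by_contra hyz
  exact hall ⟨z, hz, y, hy, hzn, hyn.trans hzn, hyz, hyt, fun x hx hxn => hmax ⟨hx, hxn⟩⟩

theorem exists_central_one_lt_norm {G : Subgroup (E →L[ℝ] E)ˣ}
    (hsim : ∀ g ∈ G, ∀ x : E, ‖(g : E →L[ℝ] E) x‖ = ‖(g : E →L[ℝ] E)‖ * ‖x‖)
    (hclosed : IsClosed (G : Set (E →L[ℝ] E)ˣ)) (hnc : ¬ IsCompact (G : Set (E →L[ℝ] E)ˣ)) :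
    ∃ z ∈ G, 1 < ‖(z : E →L[ℝ] E)‖ ∧ ∀ g ∈ G, z * g = g * z := by
  obtain ⟨g, hg, hg1⟩ := exists_one_lt_norm_of_not_isCompact hsim hclosed hnc
  by_contra! hcon
  obtain ⟨r, hr⟩ : ∃ r, ‖(g : E →L[ℝ] E)‖ = r := ⟨_, rfl⟩
  rw [hr] at hg1
  have hr0 : 0 < r := one_pos.trans hg1
  have hmul : ∀ x ∈ G, ∀ y ∈ G,
      ‖((x * y : (E →L[ℝ] E)ˣ) : E →L[ℝ] E)‖ = ‖(x : E →L[ℝ] E)‖ * ‖(y : E →L[ℝ] E)‖ :=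
    fun x hx y hy => norm_mul_of_similarity (hsim x hx) (hsim y hy)
  have hgpow : ∀ n : ℕ, ‖((g ^ n : (E →L[ℝ] E)ˣ) : E →L[ℝ] E)‖ = r ^ n := by
    intro n
    induction n with
    | zero => simp
    | succ n ih => rw [pow_succ, hmul _ (pow_mem hg n) _ hg, ih, hr, pow_succ]
  have hu : star (r⁻¹ • (g : E →L[ℝ] E)) * (r⁻¹ • (g : E →L[ℝ] E)) = 1 :=
    hr ▸ star_mul_self_normalize (hsim g hg) g.ne_zero
  obtain ⟨N, hN, hlim⟩ := exists_pow_tendsto_one hu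
  have hpair := fun j => exists_ne_traceCLM_max hsim hclosed (pow_pos hr0 (N j))
    ⟨g ^ N j, pow_mem hg _, hgpow _⟩
    (fun z hz hzn => hcon z hz (hzn ▸ one_lt_pow₀ hg1 (hN j).ne'))
  choose z hz y hy hzn hyn hne htr hmax using hpair
  have hpos : ∀ j, 0 < (r ^ N j)⁻¹ := fun j => inv_pos.2 (pow_pos hr0 _)
  let v : ℕ → E →L[ℝ] E := fun j => (r ^ N j)⁻¹ • (z j : E →L[ℝ] E)
  let k : ℕ → (E →L[ℝ] E)ˣ := fun j => (z j)⁻¹ * y j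
  have hkG : ∀ j, k j ∈ G := fun j => mul_mem (inv_mem (hz j)) (hy j)
  have hzk : ∀ j, z j * k j = y j := fun j => mul_inv_cancel_left _ _
  have hkn : ∀ j, ‖(k j : E →L[ℝ] E)‖ = 1 := by
    intro j
    have h := hmul _ (hz j) _ (hkG j)
    rw [hzk, hyn, hzn] at h
    exact mul_left_cancel₀ (pow_pos hr0 (N j)).ne' (by rw [← h, mul_one])
  have hko : ∀ j, star (k j : E →L[ℝ] E) * k j = 1 := by
    intro j
    have h := star_mul_self_normalize (hsim _ (hkG j)) (k j).ne_zero
    rwa [hkn, inv_one, one_smul] at h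
  have hkinv : ∀ j, star (k j : E →L[ℝ] E) = ((k j)⁻¹ : (E →L[ℝ] E)ˣ) := fun j =>
    (Units.inv_eq_of_mul_eq_one_left (hko j)).symm
  have hkinvn : ∀ j, ‖(((k j)⁻¹ : (E →L[ℝ] E)ˣ) : E →L[ℝ] E)‖ = 1 := fun j => by
    rw [norm_inv_of_similarity (hsim _ (hkG j)) (hsim _ (inv_mem (hkG j))), hkn, inv_one]
  have hvk : ∀ j, v j * k j = (r ^ N j)⁻¹ • (y j : E →L[ℝ] E) := fun j => by
    rw [smul_mul_assoc, ← Units.val_mul, hzk]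
  have hvo : ∀ j, star (v j) * v j = 1 := fun j => by
    have h := star_mul_self_normalize (hsim _ (hz j)) (z j).ne_zero
    rwa [hzn] at h
  have hvko : ∀ j, star (v j * k j) * (v j * k j) = 1 := fun j => by
    have h := star_mul_self_normalize (hsim _ (hy j)) (y j).ne_zero
    rwa [hyn, ← hvk] at h
  have hvtr : Tendsto (fun j => traceCLM E (v j)) atTop (𝓝 (traceCLM E 1)) := by
    refine tendsto_of_tendsto_of_tendsto_of_le_of_le
      (((traceCLM E).continuous.tendsto _).comp hlim) tendsto_const_nhds (fun j => ?_) (fun j => ?_)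
    · simp only [Function.comp_apply, smul_pow, inv_pow, map_smul, smul_eq_mul, v]
      refine mul_le_mul_of_nonneg_left ?_ (hpos j).le
      rw [← Units.val_pow_eq_pow_val]
      exact hmax j _ (pow_mem hg _) (hgpow _)
    · have := (sq_nonneg _).trans (sq_norm_sub_one_le_of_star_mul_self (hvo j))
      linarith
  have hvktr : ∀ j, traceCLM E (v j * k j) = traceCLM E (v j) := fun j => by
    rw [hvk, map_smul, map_smul, htr]
  have hv1 := tendsto_one_of_tendsto_traceCLM hvo hvtr
  have hvk1 : Tendsto (fun j => v j * (k j : E →L[ℝ] E)) atTop (𝓝 1) :=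
    tendsto_one_of_tendsto_traceCLM hvko (by simpa only [hvktr] using hvtr)
  have hk1 : Tendsto (fun j => (k j : E →L[ℝ] E)) atTop (𝓝 1) := by
    have h := hv1.star.mul hvk1
    rw [star_one, one_mul] at h
    exact h.congr fun j => by rw [← mul_assoc, hvo, one_mul]
  have hbound : ∀ j, ∀ x ∈ G, ∀ h ∈ G, ‖(x : E →L[ℝ] E)‖ = r ^ N j → ‖(h : E →L[ℝ] E)‖ = 1 →
      traceCLM E ((r ^ N j)⁻¹ • (x : E →L[ℝ] E) * h) ≤ traceCLM E (v j) := by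
    intro j x hx h hh hxn hhn
    rw [smul_mul_assoc, map_smul, map_smul, ← Units.val_mul]
    refine mul_le_mul_of_nonneg_left (hmax j _ (mul_mem hx hh) ?_) (hpos j).le
    rw [hmul x hx h hh, hxn, hhn, mul_one]
  refine not_forall_traceCLM_mul_le hko (fun j h => ?_) hv1 hk1 (fun n m => ?_) (fun n m => ?_)
    (fun n m => ?_) (fun n m => ?_)
  · refine hne j ?_
    rw [← hzk j, Units.val_eq_one.1 h, mul_one]
  · exact hbound n _ (hz n) _ (hkG m) (hzn n) (hkn m)
  · rw [hkinv]
    exact hbound n _ (hz n) _ (inv_mem (hkG m)) (hzn n) (hkinvn m)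
  · rw [hvktr, hvk]
    exact hbound n _ (hy n) _ (hkG m) (hyn n) (hkn m)
  · rw [hvktr, hvk, hkinv]
    exact hbound n _ (hy n) _ (inv_mem (hkG m)) (hyn n) (hkinvn m)

end SimilarityGroups

/-- Structure of closed noncompact subgroups of the similarity group of `ℝ^d`:
the set of norms is either all of `(0,∞)` or a cyclic group `{pⁿ : n ∈ ℤ}` with `p > 1`,
and the subgroup contains a central element of norm `> 1`. -/
theorem closed_noncompact_similarity_subgroup_structure {d : ℕ} (hd : 0 < d)
    (G₁ : Subgroup (EndV d)ˣ)
    (hsim : ∀ g ∈ G₁, ∀ x : Euc d, ‖(↑g : EndV d) x‖ = ‖(↑g : EndV d)‖ * ‖x‖)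
    (hclosed : IsClosed (G₁ : Set (EndV d)ˣ))
    (hnoncompact : ¬ IsCompact (G₁ : Set (EndV d)ˣ)) :
    ({r : ℝ | ∃ g ∈ G₁, r = ‖(↑g : EndV d)‖} = Set.Ioi (0 : ℝ) ∨
      ∃ p : ℝ, 1 < p ∧
        {r : ℝ | ∃ g ∈ G₁, r = ‖(↑g : EndV d)‖} = {r : ℝ | ∃ n : ℤ, r = p ^ n}) ∧
    ∃ z ∈ G₁, 1 < ‖(↑z : EndV d)‖ ∧ ∀ g ∈ G₁, z * g = g * z := by
  have : Nonempty (Fin d) := ⟨⟨0, hd⟩⟩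
  exact ⟨norms_eq_Ioi_or_eq_zpowers hsim hclosed hnoncompact,
    exists_central_one_lt_norm hsim hclosed hnoncompact⟩
end
end
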